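/- arXiv:2506.24054 — 2 statements merged into one kernel-verified Lean document; each statement's English description precedes it below -/
import Mathlib

section
/- For every s ∈ ℕ, s ≥ 1, there is a constant c_s > 0 with the following property: for every i ≥ 2 and every f : [0,1] → ℝ with continuous derivatives up to order s, the Chebyshev interpolation operator U^i (Lagrange interpolation at the m_i = 2^{i−1}+1 Chebyshev extrema points) satisfies ‖f − U^i(f)‖_∞ ≤ c_s · i · 2^{−i·s} · max_{0 ≤ j ≤ s} ‖f^{(j)}‖_∞. -/
noncomputable section

/-- `m_i = 2^{i−1} + 1` Chebyshev extrema points in `[0,1]` at level `i ≥ 2`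
(`j = 1,…,m_i`): `x^i_j = 1/2 − (1/2)·cos((j−1)π/(m_i−1))`. -/
def chebNode (i j : ℕ) : ℝ :=
  1 / 2 - (1 / 2) * Real.cos (((j : ℝ) - 1) * Real.pi / ((2 ^ (i - 1) + 1 : ℝ) - 1))

open Polynomial

/-- The Dirichlet-type kernel `1 + 2 ∑_{j=1}^{n-1} cos (j u) + cos (n u)`. -/
def modifiedDirichlet (n : ℕ) (u : ℝ) : ℝ :=
  ∑ j ∈ Finset.range n, (Real.cos (j * u) + Real.cos ((j + 1) * u))

lemma modifiedDirichlet_mul_sin (n : ℕ) (u : ℝ) :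
    modifiedDirichlet n u * Real.sin (u / 2) = Real.sin (n * u) * Real.cos (u / 2) := by
  unfold modifiedDirichlet
  induction n with
  | zero => simp
  | succ n ih =>
    rw [Finset.sum_range_succ, add_mul, ih]
    have h1 : Real.sin ((n + 1) * u) = Real.sin (n * u) * Real.cos u
        + Real.cos (n * u) * Real.sin u := by rw [← Real.sin_add]; ring_nf
    have h2 : Real.cos ((n + 1) * u) = Real.cos (n * u) * Real.cos u
        - Real.sin (n * u) * Real.sin u := by rw [← Real.cos_add]; ring_nf
    have h3 : Real.sin u = 2 * Real.sin (u / 2) * Real.cos (u / 2) := by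
      rw [← Real.sin_two_mul]; ring_nf
    have h4 : Real.cos u = 2 * Real.cos (u / 2) ^ 2 - 1 := by
      rw [← Real.cos_two_mul]; ring_nf
    push_cast
    rw [h1, h2, h3, h4]
    have h5 : Real.sin (u / 2) ^ 2 = 1 - Real.cos (u / 2) ^ 2 := Real.sin_sq _
    linear_combination (-2 * Real.sin (n * u) * Real.cos (u / 2)) * h5

lemma abs_modifiedDirichlet_le (n : ℕ) (u : ℝ) : |modifiedDirichlet n u| ≤ 2 * n := by
  unfold modifiedDirichlet
  refine (Finset.abs_sum_le_sum_abs _ _).trans ?_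
  refine (Finset.sum_le_card_nsmul _ _ 2 fun j _ => ?_).trans (by simp [mul_comm])
  refine (abs_add_le _ _).trans ?_
  linarith [Real.abs_cos_le_one (j * u), Real.abs_cos_le_one ((j + 1) * u)]

lemma abs_modifiedDirichlet_mul_abs_sin_le (n : ℕ) (u : ℝ) :
    |modifiedDirichlet n u| * |Real.sin (u / 2)| ≤ 1 := by
  rw [← abs_mul, modifiedDirichlet_mul_sin, abs_mul]
  exact mul_le_one₀ (Real.abs_sin_le_one _) (abs_nonneg _) (Real.abs_cos_le_one _)

lemma modifiedDirichlet_eq_zero {n : ℕ} {u : ℝ} (h : Real.sin (n * u) = 0)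
    (hu : Real.sin (u / 2) ≠ 0) : modifiedDirichlet n u = 0 := by
  have := modifiedDirichlet_mul_sin n u
  rw [h, zero_mul] at this
  exact (mul_eq_zero.mp this).resolve_right hu

lemma modifiedDirichlet_of_sin_eq_zero {n : ℕ} {u : ℝ} (hu : Real.sin (u / 2) = 0) :
    modifiedDirichlet n u = 2 * n := by
  obtain ⟨m, hm⟩ := Real.sin_eq_zero_iff.mp hu
  have h : ∀ j : ℤ, Real.cos (j * u) = 1 := fun j => by
    rw [show (j : ℝ) * u = (j * m : ℤ) * (2 * Real.pi) by push_cast; linear_combination -2 * j * hm]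
    exact Real.cos_int_mul_two_pi _
  unfold modifiedDirichlet
  have : ∀ j ∈ Finset.range n, Real.cos (j * u) + Real.cos ((j + 1) * u) = 2 := fun j _ => by
    have h1 := h j
    have h2 := h (j + 1)
    push_cast at h1 h2
    rw [h1, h2]; norm_num
  rw [Finset.sum_congr rfl this]
  simp [mul_comm]

/-- The polynomial of degree at most `n` whose value at `cos θ` is the symmetrized kernel
`modifiedDirichlet n (θ - φ) + modifiedDirichlet n (θ + φ)`. -/
def dirichletPoly (n : ℕ) (φ : ℝ) : ℝ[X] :=
  ∑ j ∈ Finset.range n, (C (2 * Real.cos (j * φ)) * Chebyshev.T ℝ j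
    + C (2 * Real.cos ((j + 1) * φ)) * Chebyshev.T ℝ (j + 1))

lemma eval_dirichletPoly (n : ℕ) (φ θ : ℝ) :
    (dirichletPoly n φ).eval (Real.cos θ)
      = modifiedDirichlet n (θ - φ) + modifiedDirichlet n (θ + φ) := by
  unfold dirichletPoly modifiedDirichlet
  rw [eval_finsetSum, ← Finset.sum_add_distrib]
  refine Finset.sum_congr rfl fun j _ => ?_
  simp only [eval_add, eval_mul, eval_C, Chebyshev.T_real_cos, mul_sub, mul_add, Real.cos_sub,
    Real.cos_add]
  push_cast
  ring

lemma natDegree_dirichletPoly_le (n : ℕ) (φ : ℝ) : (dirichletPoly n φ).natDegree ≤ n := by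
  refine natDegree_sum_le_of_forall_le _ _ fun j hj => ?_
  have hj := Finset.mem_range.mp hj
  refine natDegree_add_le_of_degree_le ?_ ?_ <;> refine (natDegree_C_mul_le _ _).trans ?_ <;>
    rw [Chebyshev.natDegree_T] <;> omega

lemma sin_half_natCast_pi_div_eq_zero {n : ℕ} (hn : 0 < n) {m : ℤ} (h : |m| < 2 * n)
    (hs : Real.sin (m * Real.pi / n / 2) = 0) : m = 0 := by
  have hn' : (0 : ℝ) < n := by exact_mod_cast hn
  have hm : (|m| : ℝ) < 2 * n := by exact_mod_cast h
  obtain ⟨h1, h2⟩ := abs_lt.mp hm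
  rw [Real.sin_eq_zero_iff_of_lt_of_lt] at hs
  · have : (m : ℝ) * Real.pi = 0 := by
      field_simp at hs; linarith
    simpa [Real.pi_ne_zero] using this
  · rw [div_div, lt_div_iff₀ (by positivity)]; nlinarith [Real.pi_pos]
  · rw [div_div, div_lt_iff₀ (by positivity)]; nlinarith [Real.pi_pos]

lemma modifiedDirichlet_node {n : ℕ} (hn : 0 < n) {m : ℤ} (h : |m| < 2 * n) (hm : m ≠ 0) :
    modifiedDirichlet n (m * Real.pi / n) = 0 := by
  have hn' : (0 : ℝ) < n := by exact_mod_cast hn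
  refine modifiedDirichlet_eq_zero ?_ fun hs => hm (sin_half_natCast_pi_div_eq_zero hn h hs)
  rw [mul_div_cancel₀ _ hn'.ne']
  exact Real.sin_int_mul_pi m

lemma modifiedDirichlet_node_nonneg {n : ℕ} (hn : 0 < n) (m : ℤ) :
    0 ≤ modifiedDirichlet n (m * Real.pi / n) := by
  have hn' : (0 : ℝ) < n := by exact_mod_cast hn
  by_cases hs : Real.sin (m * Real.pi / n / 2) = 0
  · rw [modifiedDirichlet_of_sin_eq_zero hs]; positivity
  · rw [modifiedDirichlet_eq_zero ?_ hs]
    rw [mul_div_cancel₀ _ hn'.ne']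
    exact Real.sin_int_mul_pi m

lemma eval_dirichletPoly_node_of_ne {n : ℕ} (hn : 0 < n) {k l : ℕ} (hk : k ≤ n) (hl : l ≤ n)
    (hkl : k ≠ l) :
    (dirichletPoly n (k * Real.pi / n)).eval (Real.cos (l * Real.pi / n)) = 0 := by
  rw [eval_dirichletPoly]
  have h1 := modifiedDirichlet_node hn (m := (l : ℤ) - k) (by rw [abs_lt]; omega) (by omega)
  have h2 := modifiedDirichlet_node hn (m := (l : ℤ) + k) (by rw [abs_lt]; omega) (by omega)
  push_cast at h1 h2
  rw [← sub_div, ← add_div, ← sub_mul, ← add_mul, h1, h2, add_zero]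

lemma two_mul_le_eval_dirichletPoly_node {n : ℕ} (hn : 0 < n) (k : ℕ) :
    2 * n ≤ (dirichletPoly n (k * Real.pi / n)).eval (Real.cos (k * Real.pi / n)) := by
  rw [eval_dirichletPoly, sub_self, modifiedDirichlet_of_sin_eq_zero (by simp), ← add_div,
    ← add_mul]
  have := modifiedDirichlet_node_nonneg hn (k + k)
  push_cast at this
  linarith

lemma abs_modifiedDirichlet_mul_le {n : ℕ} {d u : ℝ}
    (hu : d ≤ n * |Real.sin (u / 2)|) : |modifiedDirichlet n u| * (1 + d) ≤ 3 * n := by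
  have h1 := abs_modifiedDirichlet_le n u
  have h2 := abs_modifiedDirichlet_mul_abs_sin_le n u
  have h3 := mul_le_mul_of_nonneg_left hu (abs_nonneg (modifiedDirichlet n u))
  nlinarith

lemma abs_eval_dirichletPoly_le {n : ℕ} (hn : 0 < n) {k : ℕ} (hk : k ≤ n) {θ : ℝ} (h0 : 0 ≤ θ)
    (hπ : θ ≤ Real.pi) :
    |(dirichletPoly n (k * Real.pi / n)).eval (Real.cos θ)|
      ≤ 6 * n * (1 + |n * θ / Real.pi - k|)⁻¹ := by
  have hn' : (0 : ℝ) < n := by exact_mod_cast hn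
  have hk' : (k : ℝ) ≤ n := by exact_mod_cast hk
  have hpi := Real.pi_pos
  set φ := (k : ℝ) * Real.pi / n with hφ
  have hφ0 : 0 ≤ φ := by positivity
  have hφπ : φ ≤ Real.pi := by rw [hφ, div_le_iff₀ hn']; nlinarith
  set d := |n * θ / Real.pi - k| with hd
  have hd' : d = n * (2 / Real.pi * |(θ - φ) / 2|) := by
    have : n * θ / Real.pi - k = n * (2 / Real.pi * ((θ - φ) / 2)) := by
      rw [hφ]; field_simp
    rw [hd, this, abs_mul, abs_mul, abs_of_pos hn', abs_of_pos (a := 2 / Real.pi) (by positivity)]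
  have hs : 2 / Real.pi * |(θ - φ) / 2| ≤ |Real.sin ((θ - φ) / 2)| := by
    refine Real.mul_abs_le_abs_sin ?_
    rw [abs_le]; constructor <;> linarith
  have hs' : |Real.sin ((θ - φ) / 2)| ≤ |Real.sin ((θ + φ) / 2)| := by
    have a1 : 0 ≤ Real.sin (θ / 2) := Real.sin_nonneg_of_nonneg_of_le_pi (by linarith) (by linarith)
    have a2 : 0 ≤ Real.sin (φ / 2) := Real.sin_nonneg_of_nonneg_of_le_pi (by linarith) (by linarith)
    have a3 : 0 ≤ Real.cos (θ / 2) := Real.cos_nonneg_of_mem_Icc ⟨by linarith, by linarith⟩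
    have a4 : 0 ≤ Real.cos (φ / 2) := Real.cos_nonneg_of_mem_Icc ⟨by linarith, by linarith⟩
    rw [sub_div, add_div, Real.sin_sub, Real.sin_add]
    have := mul_nonneg a1 a4
    have := mul_nonneg a3 a2
    refine (abs_le.mpr ⟨?_, ?_⟩).trans (le_abs_self _) <;> linarith
  have h1 := abs_modifiedDirichlet_mul_le (n := n) (u := θ - φ)
    (hd'.trans_le (mul_le_mul_of_nonneg_left hs hn'.le))
  have h2 := abs_modifiedDirichlet_mul_le (n := n) (u := θ + φ)
    (hd'.trans_le (mul_le_mul_of_nonneg_left (hs.trans hs') hn'.le))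
  have hd0 : 0 ≤ d := abs_nonneg _
  rw [eval_dirichletPoly, ← div_eq_mul_inv, le_div_iff₀ (by positivity)]
  nlinarith [abs_add_le (modifiedDirichlet n (θ - φ)) (modifiedDirichlet n (θ + φ))]

lemma sum_inv_one_add_abs_sub_le {n : ℕ} {x : ℝ} (h0 : 0 ≤ x) (hx : x ≤ n) :
    ∑ k ∈ Finset.range (n + 1), (1 + |x - k|)⁻¹ ≤ 2 * (harmonic (n + 1) : ℝ) := by
  set m := ⌊x⌋₊ with hm
  have hm1 : (m : ℝ) ≤ x := Nat.floor_le h0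
  have hm2 : x < m + 1 := Nat.lt_floor_add_one x
  have hmn : m ≤ n := by
    have : (m : ℝ) ≤ n := hm1.trans hx
    exact_mod_cast this
  have hH : ∀ r ≤ n + 1, ∑ j ∈ Finset.range r, ((j : ℝ) + 1)⁻¹ ≤ harmonic (n + 1) := by
    intro r hr
    rw [harmonic]
    push_cast
    exact Finset.sum_le_sum_of_subset_of_nonneg (Finset.range_mono hr)
      fun j _ _ => by positivity
  rw [show n + 1 = (m + 1) + (n - m) by omega, Finset.sum_range_add,
    show (m + 1) + (n - m) = n + 1 by omega, two_mul]
  refine add_le_add ?_ ?_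
  · refine le_trans ?_ (hH (m + 1) (by omega))
    rw [← Finset.sum_range_reflect]
    refine Finset.sum_le_sum fun j hj => ?_
    have hj := Finset.mem_range.mp hj
    refine inv_anti₀ (by positivity) ?_
    rw [Nat.add_sub_cancel, Nat.cast_sub (by omega)]
    linarith [le_abs_self (x - ((m : ℝ) - j))]
  · refine le_trans ?_ (hH (n - m) (by omega))
    refine Finset.sum_le_sum fun j hj => ?_
    refine inv_anti₀ (by positivity) ?_
    push_cast
    linarith [neg_abs_le (x - ((m : ℝ) + 1 + j))]

/-- The Lebesgue constant of interpolation at the extrema of the Chebyshev polynomial of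
degree `n` is at most `6` times a harmonic number. -/
lemma abs_eval_cos_le_of_abs_eval_node_le {n : ℕ} (hn : 0 < n) {p : ℝ[X]} (hp : p.natDegree ≤ n)
    {ε : ℝ} (h : ∀ k ≤ n, |p.eval (Real.cos (k * Real.pi / n))| ≤ ε) {θ : ℝ} (h0 : 0 ≤ θ)
    (hπ : θ ≤ Real.pi) : |p.eval (Real.cos θ)| ≤ 6 * (harmonic (n + 1) : ℝ) * ε := by
  have hn' : (0 : ℝ) < n := by exact_mod_cast hn
  set v : ℕ → ℝ := fun k => Real.cos (k * Real.pi / n) with hv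
  set E : ℕ → ℝ[X] := fun k => dirichletPoly n (k * Real.pi / n) with hE
  have hEpos : ∀ k, 2 * (n : ℝ) ≤ (E k).eval (v k) := fun k =>
    two_mul_le_eval_dirichletPoly_node hn k
  have hE0 : ∀ k ≤ n, ∀ l ≤ n, k ≠ l → (E k).eval (v l) = 0 := fun k hk l hl hkl =>
    eval_dirichletPoly_node_of_ne hn hk hl hkl
  have hinj : Set.InjOn v (Finset.range (n + 1)) := by
    intro k hk l hl hkl
    by_contra hne
    simp only [Finset.coe_range, Set.mem_Iio] at hk hl
    have := hE0 k (by omega) l (by omega) hne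
    rw [← hkl] at this
    linarith [hEpos k]
  have hdeg : ∀ q : ℝ[X], q.natDegree ≤ n → q.degree < (Finset.range (n + 1)).card := by
    intro q hq
    rw [Finset.card_range]
    exact (degree_le_natDegree).trans_lt (by exact_mod_cast Nat.lt_succ_of_le hq)
  have hrep : p = ∑ k ∈ Finset.range (n + 1), C (p.eval (v k) / (E k).eval (v k)) * E k := by
    refine eq_of_degrees_lt_of_eval_index_eq _ hinj (hdeg _ hp) (hdeg _ ?_) ?_
    · exact natDegree_sum_le_of_forall_le _ _ fun k _ =>
        (natDegree_C_mul_le _ _).trans (natDegree_dirichletPoly_le _ _)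
    · intro l hl
      rw [eval_finsetSum, Finset.sum_eq_single_of_mem l hl]
      · rw [eval_mul, eval_C, div_mul_cancel₀]
        linarith [hEpos l]
      · intro k hk hkl
        rw [Finset.mem_range] at hk hl
        rw [eval_mul, hE0 k (by omega) l (by omega) hkl, mul_zero]
  have hε : 0 ≤ ε := (abs_nonneg _).trans (h 0 (Nat.zero_le _))
  have hterm : ∀ k ∈ Finset.range (n + 1),
      |(C (p.eval (v k) / (E k).eval (v k)) * E k).eval (Real.cos θ)|
        ≤ 3 * ε * (1 + |n * θ / Real.pi - k|)⁻¹ := by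
    intro k hk
    have hk : k ≤ n := by rw [Finset.mem_range] at hk; omega
    rw [eval_mul, eval_C, abs_mul, abs_div, abs_of_pos (a := (E k).eval (v k))
      (by linarith [hEpos k])]
    have h1 : |p.eval (v k)| / (E k).eval (v k) ≤ ε / (2 * n) :=
      div_le_div₀ hε (h k hk) (by positivity) (hEpos k)
    have h2 := abs_eval_dirichletPoly_le hn hk h0 hπ
    refine (mul_le_mul h1 h2 (abs_nonneg _) (by positivity)).trans (le_of_eq ?_)
    field_simp
    ring
  have hsum := sum_inv_one_add_abs_sub_le (n := n) (x := n * θ / Real.pi)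
    (by have := Real.pi_pos; positivity)
    (by rw [div_le_iff₀ Real.pi_pos]; gcongr)
  calc |p.eval (Real.cos θ)|
      = |∑ k ∈ Finset.range (n + 1),
          (C (p.eval (v k) / (E k).eval (v k)) * E k).eval (Real.cos θ)| := by
        rw [← eval_finsetSum, ← hrep]
    _ ≤ ∑ k ∈ Finset.range (n + 1), 3 * ε * (1 + |n * θ / Real.pi - k|)⁻¹ :=
        (Finset.abs_sum_le_sum_abs _ _).trans (Finset.sum_le_sum hterm)
    _ ≤ 3 * ε * (2 * (harmonic (n + 1) : ℝ)) := by
        rw [← Finset.mul_sum]; gcongr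
    _ = 6 * (harmonic (n + 1) : ℝ) * ε := by ring

lemma sum_cos_int_mul_add_eq_zero {N : ℕ} {m : ℤ} (hm : m ≠ 0) (hmN : |m| < N) (θ : ℝ) :
    ∑ k ∈ Finset.range N, Real.cos (m * (2 * Real.pi * k / N + θ)) = 0 := by
  have hN : (0 : ℝ) < N := by
    have : (0 : ℤ) < N := (abs_nonneg m).trans_lt hmN
    exact_mod_cast this
  have hm' : (|m| : ℝ) < N := by exact_mod_cast hmN
  obtain ⟨hm1, hm2⟩ := abs_lt.mp hm'
  have hpi := Real.pi_pos
  set h : ℝ := m * Real.pi / N with hh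
  have hs : Real.sin h ≠ 0 := by
    intro hs
    rw [Real.sin_eq_zero_iff_of_lt_of_lt] at hs
    · have : (m : ℝ) * Real.pi = 0 := by
        rw [hh, div_eq_zero_iff] at hs
        exact hs.resolve_right hN.ne'
      simp [hpi.ne', hm] at this
    · rw [hh, lt_div_iff₀ hN]; nlinarith
    · rw [hh, div_lt_iff₀ hN]; nlinarith
  have htel : ∀ k : ℕ, 2 * Real.sin h * Real.cos (m * (2 * Real.pi * k / N + θ))
      = Real.sin (m * θ - h + (k + 1 : ℕ) * (2 * h)) - Real.sin (m * θ - h + k * (2 * h)) := by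
    intro k
    rw [show m * (2 * Real.pi * k / N + θ) = m * θ + k * (2 * h) by rw [hh]; ring,
      show m * θ - h + (k + 1 : ℕ) * (2 * h) = (m * θ + k * (2 * h)) + h by push_cast; ring,
      show m * θ - h + k * (2 * h) = (m * θ + k * (2 * h)) - h by ring,
      Real.sin_add _ h, Real.sin_sub _ h]
    ring
  have h0 : 2 * Real.sin h * ∑ k ∈ Finset.range N, Real.cos (m * (2 * Real.pi * k / N + θ)) = 0 := by
    rw [Finset.mul_sum, Finset.sum_congr rfl fun k _ => htel k,
      Finset.sum_range_sub fun k : ℕ => Real.sin (m * θ - h + k * (2 * h)),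
      show m * θ - h + N * (2 * h) = (m * θ - h + (0 : ℕ) * (2 * h)) + m * (2 * Real.pi) by
        rw [hh]; field_simp; push_cast; ring,
      Real.sin_add_int_mul_two_pi, sub_self]
  exact (mul_eq_zero.mp h0).resolve_left (mul_ne_zero two_ne_zero hs)

lemma sum_cos_int_mul_add {N : ℕ} {m : ℤ} (hmN : |m| < N) (θ : ℝ) :
    ∑ k ∈ Finset.range N, Real.cos (m * (2 * Real.pi * k / N + θ)) = if m = 0 then (N : ℝ) else 0 := by
  split_ifs with h
  · simp [h]
  · exact sum_cos_int_mul_add_eq_zero h hmN θ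

/-- The Fejér–Korovkin kernel of degree `n`, up to normalization: the squared modulus of
`∑ j ≤ n, sin ((j + 1) π / (n + 2)) exp (i j u)`. -/
def korovkinKernel (n : ℕ) (u : ℝ) : ℝ :=
  ∑ j ∈ Finset.range (n + 1), ∑ l ∈ Finset.range (n + 1),
    Real.sin ((j + 1) * (Real.pi / (n + 2))) * Real.sin ((l + 1) * (Real.pi / (n + 2)))
      * Real.cos (((j : ℤ) - l : ℤ) * u)

/-- The normalizing constant of `korovkinKernel`. -/
def korovkinMass (n : ℕ) : ℝ :=
  ∑ j ∈ Finset.range (n + 1), Real.sin ((j + 1) * (Real.pi / (n + 2))) ^ 2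

lemma korovkinMass_pos (n : ℕ) : 0 < korovkinMass n := by
  refine Finset.sum_pos (fun j hj => ?_) ⟨0, by simp⟩
  have hj : j + 1 < n + 2 := by rw [Finset.mem_range] at hj; omega
  have hj' : (j : ℝ) + 1 < n + 2 := by exact_mod_cast hj
  refine pow_pos (Real.sin_pos_of_pos_of_lt_pi (by have := Real.pi_pos; positivity) ?_) 2
  rw [← mul_div_assoc, div_lt_iff₀ (by positivity)]
  nlinarith [Real.pi_pos]

lemma korovkinKernel_nonneg (n : ℕ) (u : ℝ) : 0 ≤ korovkinKernel n u := by
  have : korovkinKernel n u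
      = (∑ j ∈ Finset.range (n + 1), Real.sin ((j + 1) * (Real.pi / (n + 2))) * Real.cos (j * u)) ^ 2
      + (∑ j ∈ Finset.range (n + 1), Real.sin ((j + 1) * (Real.pi / (n + 2))) * Real.sin (j * u)) ^ 2
      := by
    rw [sq, sq, Finset.sum_mul_sum, Finset.sum_mul_sum, ← Finset.sum_add_distrib]
    refine Finset.sum_congr rfl fun j _ => ?_
    rw [← Finset.sum_add_distrib]
    refine Finset.sum_congr rfl fun l _ => ?_
    push_cast
    rw [sub_mul, Real.cos_sub]
    ring
  rw [this]
  positivity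

lemma sum_korovkinKernel (n : ℕ) (θ : ℝ) :
    ∑ k ∈ Finset.range (n + 2), korovkinKernel n (2 * Real.pi * k / (n + 2 : ℕ) + θ)
      = (n + 2) * korovkinMass n := by
  unfold korovkinKernel korovkinMass
  rw [Finset.sum_comm, Finset.mul_sum]
  refine Finset.sum_congr rfl fun j hj => ?_
  rw [Finset.sum_comm, Finset.sum_eq_single_of_mem j hj]
  · simp only [sub_self, Int.cast_zero, zero_mul, Real.cos_zero, mul_one, Finset.sum_const,
      Finset.card_range, nsmul_eq_mul]
    push_cast
    ring
  · intro l hl hlj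
    rw [Finset.mem_range] at hl hj
    rw [← Finset.mul_sum, sum_cos_int_mul_add_eq_zero (by omega) (by rw [abs_lt]; omega), mul_zero]

lemma sum_cos_mul_korovkinKernel (n : ℕ) (θ : ℝ) :
    ∑ k ∈ Finset.range (n + 2), Real.cos (2 * Real.pi * k / (n + 2 : ℕ) + θ)
        * korovkinKernel n (2 * Real.pi * k / (n + 2 : ℕ) + θ)
      = (n + 2) * korovkinMass n * Real.cos (Real.pi / (n + 2)) := by
  set α := Real.pi / (n + 2) with hα
  set c : ℕ → ℝ := fun j => Real.sin (j * α) with hc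
  have hcN : c (n + 2) = 0 := by
    simp only [hc, hα]; push_cast
    rw [mul_div_cancel₀ _ (by positivity), Real.sin_pi]
  have hc0 : c 0 = 0 := by simp [hc]
  have hrec : ∀ j, c (j + 2) + c j = 2 * Real.cos α * c (j + 1) := fun j => by
    simp only [hc]; push_cast
    rw [show ((j : ℝ) + 2) * α = (j + 1) * α + α by ring,
      show (j : ℝ) * α = (j + 1) * α - α by ring, Real.sin_add, Real.sin_sub]
    ring
  have hK : ∀ u, Real.cos u * korovkinKernel n u = ∑ j ∈ Finset.range (n + 1),
      ∑ l ∈ Finset.range (n + 1), c (j + 1) * c (l + 1) / 2 *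
        (Real.cos (((j : ℤ) + 1 - l : ℤ) * u) + Real.cos (((j : ℤ) - 1 - l : ℤ) * u)) := fun u => by
    unfold korovkinKernel
    rw [Finset.mul_sum]
    refine Finset.sum_congr rfl fun j _ => ?_
    rw [Finset.mul_sum]
    refine Finset.sum_congr rfl fun l _ => ?_
    simp only [hc]
    push_cast
    rw [show ((j : ℝ) + 1 - l) * u = (j - l) * u + u by ring,
      show ((j : ℝ) - 1 - l) * u = (j - l) * u - u by ring, Real.cos_add, Real.cos_sub]
    ring
  simp only [hK]
  rw [Finset.sum_comm]
  unfold korovkinMass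
  rw [Finset.mul_sum, Finset.sum_mul]
  refine Finset.sum_congr rfl fun j hj => ?_
  have hj := Finset.mem_range.mp hj
  rw [Finset.sum_comm]
  have hinner : ∀ l ∈ Finset.range (n + 1), ∑ k ∈ Finset.range (n + 2), c (j + 1) * c (l + 1) / 2 *
        (Real.cos (((j : ℤ) + 1 - l : ℤ) * (2 * Real.pi * k / (n + 2 : ℕ) + θ))
          + Real.cos (((j : ℤ) - 1 - l : ℤ) * (2 * Real.pi * k / (n + 2 : ℕ) + θ)))
      = c (j + 1) * (n + 2) / 2 *
        ((if l = j + 1 then c (l + 1) else 0) + (if l + 1 = j then c (l + 1) else 0)) := by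
    intro l hl
    have hl := Finset.mem_range.mp hl
    rw [← Finset.mul_sum, Finset.sum_add_distrib, sum_cos_int_mul_add (by rw [abs_lt]; omega),
      sum_cos_int_mul_add (by rw [abs_lt]; omega)]
    have e1 : (j : ℤ) + 1 - l = 0 ↔ l = j + 1 := by omega
    have e2 : (j : ℤ) - 1 - l = 0 ↔ l + 1 = j := by omega
    simp only [e1, e2]
    split_ifs <;> push_cast <;> ring
  rw [Finset.sum_congr rfl hinner, ← Finset.mul_sum, Finset.sum_add_distrib]
  have s1 : ∑ l ∈ Finset.range (n + 1), (if l = j + 1 then c (l + 1) else 0) = c (j + 2) := by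
    rw [Finset.sum_ite_eq']
    split_ifs with h
    · rfl
    · rw [Finset.mem_range] at h
      rw [show j + 2 = n + 2 by omega, hcN]
  have s2 : ∑ l ∈ Finset.range (n + 1), (if l + 1 = j then c (l + 1) else 0) = c j := by
    rcases j with _ | j
    · simp [hc0]
    · simp only [Nat.add_right_cancel_iff]
      rw [Finset.sum_ite_eq', if_pos (Finset.mem_range.mpr (by omega))]
  rw [s1, s2, hrec]
  have : Real.sin ((j + 1) * α) = c (j + 1) := by simp [hc]
  rw [this]
  ring

/-- The polynomial of degree at most `n` whose value at `cos θ` is the symmetrized kernel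
`(korovkinKernel n (φ - θ) + korovkinKernel n (φ + θ)) / 2`. -/
def korovkinPoly (n : ℕ) (φ : ℝ) : ℝ[X] :=
  ∑ j ∈ Finset.range (n + 1), ∑ l ∈ Finset.range (n + 1),
    C (Real.sin ((j + 1) * (Real.pi / (n + 2))) * Real.sin ((l + 1) * (Real.pi / (n + 2)))
      * Real.cos (((j : ℤ) - l : ℤ) * φ)) * Chebyshev.T ℝ (j - l)

lemma eval_korovkinPoly (n : ℕ) (φ θ : ℝ) : (korovkinPoly n φ).eval (Real.cos θ)
      = (korovkinKernel n (φ + -θ) + korovkinKernel n (φ + θ)) / 2 := by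
  unfold korovkinPoly korovkinKernel
  simp only [eval_finsetSum, ← Finset.sum_add_distrib, Finset.sum_div]
  refine Finset.sum_congr rfl fun j _ => Finset.sum_congr rfl fun l _ => ?_
  simp only [eval_mul, eval_C, Chebyshev.T_real_cos, mul_add, Real.cos_add, mul_neg, Real.cos_neg,
    Real.sin_neg]
  ring

lemma natDegree_korovkinPoly_le (n : ℕ) (φ : ℝ) : (korovkinPoly n φ).natDegree ≤ n := by
  refine natDegree_sum_le_of_forall_le _ _ fun j hj =>
    natDegree_sum_le_of_forall_le _ _ fun l hl => (natDegree_C_mul_le _ _).trans ?_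
  rw [Finset.mem_range] at hj hl
  rw [Chebyshev.natDegree_T]
  omega

lemma sq_cos_sub_cos_le (θ φ : ℝ) :
    (Real.cos θ - Real.cos φ) ^ 2 ≤ 2 * (1 - Real.cos (φ + θ)) := by
  rw [Real.cos_add]
  nlinarith [sq_nonneg (Real.sin θ + Real.sin φ), Real.sin_sq_add_cos_sq θ,
    Real.sin_sq_add_cos_sq φ]

/-- **Jackson's theorem** for Lipschitz functions on `[-1, 1]`. -/
lemma exists_polynomial_near_of_lipschitz {L : ℝ} {F : ℝ → ℝ}
    (hF : ∀ x ∈ Set.Icc (-1 : ℝ) 1, ∀ y ∈ Set.Icc (-1 : ℝ) 1, |F x - F y| ≤ L * |x - y|) (n : ℕ) :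
    ∃ q : ℝ[X], q.natDegree ≤ n ∧
      ∀ y ∈ Set.Icc (-1 : ℝ) 1, |F y - q.eval y| ≤ L * (Real.pi / (n + 2)) := by
  have hL : 0 ≤ L := by
    have := (abs_nonneg _).trans (hF 1 (by simp) 0 (by simp))
    simpa using this
  have hpi := Real.pi_pos
  set α := Real.pi / (n + 2) with hα
  have hα0 : 0 < α := by positivity
  set φ : ℕ → ℝ := fun k => 2 * Real.pi * k / (n + 2 : ℕ) with hφ
  set S : ℝ := (n + 2) * korovkinMass n with hS
  have hS0 : 0 < S := mul_pos (by positivity) (korovkinMass_pos n)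
  refine ⟨∑ k ∈ Finset.range (n + 2), C (F (Real.cos (φ k)) / S) * korovkinPoly n (φ k),
    natDegree_sum_le_of_forall_le _ _ fun k _ => (natDegree_C_mul_le _ _).trans
      (natDegree_korovkinPoly_le _ _), fun y hy => ?_⟩
  obtain ⟨θ, rfl⟩ : ∃ θ, Real.cos θ = y := ⟨_, Real.cos_arccos hy.1 hy.2⟩
  set W : ℕ → ℝ := fun k =>
    (korovkinKernel n (φ k + -θ) + korovkinKernel n (φ k + θ)) / 2 with hW
  have hW0 : ∀ k, 0 ≤ W k := fun k => by
    have := korovkinKernel_nonneg n (φ k + -θ)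
    have := korovkinKernel_nonneg n (φ k + θ)
    positivity
  have hWsum : ∑ k ∈ Finset.range (n + 2), W k = S := by
    rw [← Finset.sum_div, Finset.sum_add_distrib, sum_korovkinKernel, sum_korovkinKernel]
    ring
  have hmoment : ∑ k ∈ Finset.range (n + 2), (Real.cos θ - Real.cos (φ k)) ^ 2 * W k
      ≤ S * α ^ 2 := by
    calc _ ≤ ∑ k ∈ Finset.range (n + 2),
          ((korovkinKernel n (φ k + -θ) - Real.cos (φ k + -θ) * korovkinKernel n (φ k + -θ))
          + (korovkinKernel n (φ k + θ) - Real.cos (φ k + θ) * korovkinKernel n (φ k + θ))) := by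
          refine Finset.sum_le_sum fun k _ => ?_
          have h1 := mul_le_mul_of_nonneg_right (sq_cos_sub_cos_le (-θ) (φ k))
            (korovkinKernel_nonneg n (φ k + -θ))
          have h2 := mul_le_mul_of_nonneg_right (sq_cos_sub_cos_le θ (φ k))
            (korovkinKernel_nonneg n (φ k + θ))
          rw [Real.cos_neg] at h1
          simp only [hW]
          linarith
      _ = 2 * S * (1 - Real.cos α) := by
          rw [Finset.sum_add_distrib, Finset.sum_sub_distrib, Finset.sum_sub_distrib,
            sum_korovkinKernel, sum_korovkinKernel, sum_cos_mul_korovkinKernel,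
            sum_cos_mul_korovkinKernel]
          ring
      _ ≤ S * α ^ 2 := by nlinarith [Real.one_sub_sq_div_two_le_cos (x := α)]
  have hterm : ∀ k, |(F (Real.cos θ) - F (Real.cos (φ k))) * W k|
      ≤ L / (2 * α) * ((Real.cos θ - Real.cos (φ k)) ^ 2 * W k) + L * α / 2 * W k := by
    intro k
    rw [abs_mul, abs_of_nonneg (hW0 k)]
    have h1 := hF _ ⟨Real.neg_one_le_cos θ, Real.cos_le_one θ⟩ _
      ⟨Real.neg_one_le_cos (φ k), Real.cos_le_one (φ k)⟩
    have h2 : |Real.cos θ - Real.cos (φ k)|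
        ≤ ((Real.cos θ - Real.cos (φ k)) ^ 2 / α + α) / 2 := by
      rw [le_div_iff₀ two_pos, ← sub_le_iff_le_add, le_div_iff₀ hα0,
        ← sq_abs (Real.cos θ - Real.cos (φ k))]
      nlinarith [sq_nonneg (|Real.cos θ - Real.cos (φ k)| - α)]
    calc _ ≤ L * (((Real.cos θ - Real.cos (φ k)) ^ 2 / α + α) / 2) * W k := by
          refine mul_le_mul_of_nonneg_right (h1.trans ?_) (hW0 k)
          exact mul_le_mul_of_nonneg_left h2 hL
      _ = _ := by field_simp
  have hrep : F (Real.cos θ) - (∑ k ∈ Finset.range (n + 2),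
      C (F (Real.cos (φ k)) / S) * korovkinPoly n (φ k)).eval (Real.cos θ)
      = (∑ k ∈ Finset.range (n + 2), (F (Real.cos θ) - F (Real.cos (φ k))) * W k) / S := by
    simp only [sub_mul, Finset.sum_sub_distrib]
    rw [← Finset.mul_sum, hWsum, sub_div, mul_div_cancel_right₀ _ hS0.ne', eval_finsetSum,
      Finset.sum_div]
    refine congrArg _ (Finset.sum_congr rfl fun k _ => ?_)
    rw [eval_mul, eval_C, eval_korovkinPoly]
    ring
  rw [hrep, abs_div, abs_of_pos hS0, div_le_iff₀ hS0]
  calc _ ≤ ∑ k ∈ Finset.range (n + 2),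
        (L / (2 * α) * ((Real.cos θ - Real.cos (φ k)) ^ 2 * W k) + L * α / 2 * W k) :=
        (Finset.abs_sum_le_sum_abs _ _).trans (Finset.sum_le_sum fun k _ => hterm k)
    _ ≤ L / (2 * α) * (S * α ^ 2) + L * α / 2 * S := by
        rw [Finset.sum_add_distrib, ← Finset.mul_sum, ← Finset.mul_sum, hWsum]
        gcongr
    _ = L * α * S := by field_simp; ring

lemma exists_polynomial_near_of_lipschitz_unitInterval {L : ℝ} {f : ℝ → ℝ}
    (hf : ∀ x ∈ Set.Icc (0 : ℝ) 1, ∀ y ∈ Set.Icc (0 : ℝ) 1, |f x - f y| ≤ L * |x - y|) (n : ℕ) :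
    ∃ q : ℝ[X], q.natDegree ≤ n ∧
      ∀ t ∈ Set.Icc (0 : ℝ) 1, |f t - q.eval t| ≤ L * (Real.pi / (n + 2)) := by
  have hmap : ∀ y ∈ Set.Icc (-1 : ℝ) 1, (1 - y) / 2 ∈ Set.Icc (0 : ℝ) 1 := fun y hy =>
    ⟨by linarith [hy.2], by linarith [hy.1]⟩
  have hL : 0 ≤ L := by
    have := (abs_nonneg _).trans (hf 1 (by simp) 0 (by simp))
    simpa using this
  obtain ⟨q, hq, hfq⟩ := exists_polynomial_near_of_lipschitz (L := L)
    (F := fun y => f ((1 - y) / 2)) (fun x hx y hy => by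
      refine (hf _ (hmap x hx) _ (hmap y hy)).trans (mul_le_mul_of_nonneg_left ?_ hL)
      rw [show (1 - x) / 2 - (1 - y) / 2 = -((x - y) / 2) by ring, abs_neg, abs_div,
        abs_of_pos (two_pos (α := ℝ))]
      linarith [abs_nonneg (x - y)]) n
  refine ⟨q.comp (C 1 - C 2 * X), ?_, fun t ht => ?_⟩
  · refine natDegree_comp_le.trans ?_
    have : (C 1 - C 2 * X : ℝ[X]).natDegree ≤ 1 := by compute_degree
    nlinarith
  · have := hfq (1 - 2 * t) ⟨by linarith [ht.2], by linarith [ht.1]⟩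
    simpa using this

lemma exists_polynomial_derivative_eq (q : ℝ[X]) :
    ∃ Q : ℝ[X], derivative Q = q ∧ Q.natDegree ≤ q.natDegree + 1 := by
  refine ⟨∑ k ∈ Finset.range (q.natDegree + 1), C (q.coeff k / (k + 1)) * X ^ (k + 1), ?_, ?_⟩
  · conv_rhs => rw [q.as_sum_range_C_mul_X_pow]
    rw [derivative_sum]
    refine Finset.sum_congr rfl fun k _ => ?_
    rw [derivative_C_mul_X_pow, Nat.add_sub_cancel]
    congr 2
    push_cast
    field_simp
  · refine natDegree_sum_le_of_forall_le _ _ fun k hk => (natDegree_C_mul_X_pow_le _ _).trans ?_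
    rw [Finset.mem_range] at hk
    omega

/-- **Jackson's theorem** for `C^s` functions on `[0, 1]`. -/
theorem exists_polynomial_near_of_contDiffOn (s : ℕ) :
    ∃ c : ℝ, 0 < c ∧ ∀ n : ℕ, 1 ≤ n → ∀ f : ℝ → ℝ, ContDiffOn ℝ s f (Set.Icc 0 1) → ∀ M : ℝ,
      (∀ j ≤ s, ∀ x ∈ Set.Icc (0 : ℝ) 1, |iteratedDerivWithin j f (Set.Icc 0 1) x| ≤ M) →
      ∃ q : ℝ[X], q.natDegree ≤ n ∧
        ∀ t ∈ Set.Icc (0 : ℝ) 1, |f t - q.eval t| ≤ c * M / (n : ℝ) ^ s := by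
  induction s with
  | zero =>
    refine ⟨1, one_pos, fun n _ f _ M hM => ⟨0, by simp, fun t ht => ?_⟩⟩
    simpa using hM 0 le_rfl t ht
  | succ s ih =>
    obtain ⟨c, hc, h⟩ := ih
    have hpi := Real.pi_pos
    refine ⟨1 + c * 2 ^ s * Real.pi, by positivity, fun n hn f hf M hM => ?_⟩
    have hM0 : 0 ≤ M := (abs_nonneg _).trans (hM 0 (Nat.zero_le _) 0 (by simp))
    have hu : UniqueDiffOn ℝ (Set.Icc (0 : ℝ) 1) := uniqueDiffOn_Icc_zero_one
    rcases hn.eq_or_lt with rfl | hn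
    · refine ⟨0, by simp, fun t ht => ?_⟩
      have h0 := hM 0 (Nat.zero_le _) t ht
      simp only [iteratedDerivWithin_zero] at h0
      simp only [eval_zero, sub_zero, Nat.cast_one, one_pow, div_one]
      nlinarith [mul_nonneg (mul_nonneg (mul_nonneg hc.le (pow_nonneg (zero_le_two (α := ℝ)) s))
        hpi.le) hM0]
    obtain ⟨q, hq, hfq⟩ := h (n - 1) (by omega) (derivWithin f (Set.Icc 0 1))
      (hf.derivWithin hu (by norm_cast)) M fun j hj x hx => by
        rw [← iteratedDerivWithin_succ']
        exact hM (j + 1) (by omega) x hx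
    obtain ⟨Q, rfl, hQ⟩ := exists_polynomial_derivative_eq q
    have hn0 : (0 : ℝ) < n := by
      have : 0 < n := by omega
      exact_mod_cast this
    have hhalf : (n : ℝ) / 2 ≤ (n - 1 : ℕ) := by
      rw [Nat.cast_sub (by omega)]
      have : (2 : ℝ) ≤ n := by exact_mod_cast hn
      push_cast
      linarith
    have hL : ∀ t ∈ Set.Icc (0 : ℝ) 1,
        ‖derivWithin f (Set.Icc 0 1) t - (derivative Q).eval t‖ ≤ c * 2 ^ s * M / (n : ℝ) ^ s := by
      intro t ht
      refine (hfq t ht).trans ?_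
      calc c * M / ((n - 1 : ℕ) : ℝ) ^ s ≤ c * M / ((n : ℝ) / 2) ^ s := by gcongr
        _ = _ := by rw [div_pow]; field_simp
    obtain ⟨R, hR, hfR⟩ := exists_polynomial_near_of_lipschitz_unitInterval
      (f := fun t => f t - Q.eval t) (fun x hx y hy =>
        Convex.norm_image_sub_le_of_norm_hasDerivWithin_le
          (fun t ht => ((hf.differentiableOn (by simp) t ht).hasDerivWithinAt.sub
            (Q.hasDerivAt t).hasDerivWithinAt)) hL (convex_Icc 0 1) hy hx) n
    refine ⟨Q + R, natDegree_add_le_of_degree_le (by omega) hR, fun t ht => ?_⟩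
    rw [eval_add, ← sub_sub]
    refine (hfR t ht).trans ?_
    calc c * 2 ^ s * M / (n : ℝ) ^ s * (Real.pi / (n + 2))
        ≤ c * 2 ^ s * M / (n : ℝ) ^ s * (Real.pi / n) := by gcongr; linarith
      _ = (c * 2 ^ s * Real.pi) * M / (n : ℝ) ^ (s + 1) := by rw [pow_succ]; field_simp
      _ ≤ _ := by gcongr; linarith

lemma harmonic_two_pow_add_one_le (m : ℕ) : (harmonic (2 ^ m + 1) : ℝ) ≤ m + 2 := by
  refine (harmonic_le_one_add_log _).trans ?_
  have h1 : ((2 ^ m + 1 : ℕ) : ℝ) ≤ 2 ^ (m + 1) := by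
    have : 1 ≤ 2 ^ m := Nat.one_le_two_pow
    have : 2 ^ m + 1 ≤ 2 ^ (m + 1) := by rw [pow_succ]; omega
    exact_mod_cast this
  have h2 := Real.log_le_log (by positivity) h1
  rw [Real.log_pow] at h2
  push_cast at h2 ⊢
  nlinarith [Real.log_two_lt_d9]

lemma chebNode_succ (i k : ℕ) :
    chebNode i (k + 1) = (1 - Real.cos (k * Real.pi / (2 ^ (i - 1) : ℕ))) / 2 := by
  unfold chebNode
  push_cast
  rw [add_sub_cancel_right, add_sub_cancel_right]
  ring

lemma bddAbove_abs_iteratedDerivWithin {s : ℕ} {f : ℝ → ℝ}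
    (hf : ContDiffOn ℝ s f (Set.Icc 0 1)) :
    BddAbove {v : ℝ | ∃ j ≤ s, ∃ x ∈ Set.Icc (0 : ℝ) 1,
      v = |iteratedDerivWithin j f (Set.Icc 0 1) x|} := by
  have : {v : ℝ | ∃ j ≤ s, ∃ x ∈ Set.Icc (0 : ℝ) 1,
      v = |iteratedDerivWithin j f (Set.Icc 0 1) x|} = ⋃ j ∈ Set.Iic s,
        (fun x => |iteratedDerivWithin j f (Set.Icc 0 1) x|) '' Set.Icc (0 : ℝ) 1 := by
    ext v
    simp [eq_comm]
  rw [this, (Set.finite_Iic s).bddAbove_biUnion]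
  intro j hj
  refine (isCompact_Icc.image_of_continuousOn ?_).bddAbove
  exact (hf.continuousOn_iteratedDerivWithin (by exact_mod_cast hj)
    uniqueDiffOn_Icc_zero_one).abs

/-- for every `s ≥ 1` there is `c_s > 0` such that for every `i ≥ 2`
and every `f` with continuous derivatives up to order `s` on `[0,1]`, the Chebyshev
interpolation operator `U^i` (Lagrange interpolation at the `m_i = 2^{i−1}+1`
Chebyshev extrema points, i.e. the unique polynomial of degree `< m_i` agreeing
with `f` at those points) satisfies
`‖f − U^i(f)‖_∞ ≤ c_s · i · 2^{−is} · max_{0≤j≤s} ‖f^{(j)}‖_∞`. -/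
theorem chebyshev_interpolation_error (s : ℕ) (hs : 1 ≤ s) :
    ∃ c : ℝ, 0 < c ∧ ∀ i : ℕ, 2 ≤ i →
      ∀ f : ℝ → ℝ, ContDiffOn ℝ (s : ℕ∞) f (Set.Icc 0 1) →
        ∀ p : Polynomial ℝ, p.natDegree < 2 ^ (i - 1) + 1 →
          (∀ j ∈ Finset.Icc 1 (2 ^ (i - 1) + 1),
            p.eval (chebNode i j) = f (chebNode i j)) →
          ∀ t ∈ Set.Icc (0 : ℝ) 1,
            |f t - p.eval t| ≤ c * (i : ℝ) * ((2 : ℝ) ^ (i * s))⁻¹ *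
              sSup {v : ℝ | ∃ j ≤ s, ∃ x ∈ Set.Icc (0 : ℝ) 1,
                v = |iteratedDerivWithin j f (Set.Icc 0 1) x|} := by
  obtain ⟨c, hc, hJ⟩ := exists_polynomial_near_of_contDiffOn s
  refine ⟨13 * c * 2 ^ s, by positivity, fun i hi f hf p hp hpf t ht => ?_⟩
  set M := sSup {v : ℝ | ∃ j ≤ s, ∃ x ∈ Set.Icc (0 : ℝ) 1,
    v = |iteratedDerivWithin j f (Set.Icc 0 1) x|} with hM
  have hMle : ∀ j ≤ s, ∀ x ∈ Set.Icc (0 : ℝ) 1,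
      |iteratedDerivWithin j f (Set.Icc 0 1) x| ≤ M := fun j hj x hx =>
    le_csSup (bddAbove_abs_iteratedDerivWithin hf) ⟨j, hj, x, hx, rfl⟩
  have hM0 : 0 ≤ M := (abs_nonneg _).trans (hMle 0 (Nat.zero_le _) 0 (by simp))
  set n := 2 ^ (i - 1) with hn
  have hn1 : 1 ≤ n := Nat.one_le_two_pow
  obtain ⟨q, hq, hfq⟩ := hJ n hn1 f hf M hMle
  set ε := c * M / (n : ℝ) ^ s with hε
  have hε0 : 0 ≤ ε := by positivity
  have hdeg : ((q - p).comp (C (1 / 2) - C (1 / 2) * X)).natDegree ≤ n := by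
    refine natDegree_comp_le.trans ?_
    have h1 : (C (1 / 2) - C (1 / 2) * X : ℝ[X]).natDegree ≤ 1 := by compute_degree
    have h2 : (q - p).natDegree ≤ n := (natDegree_sub_le _ _).trans (max_le hq (by omega))
    nlinarith
  have heval : ∀ y, ((q - p).comp (C (1 / 2) - C (1 / 2) * X)).eval y
      = q.eval ((1 - y) / 2) - p.eval ((1 - y) / 2) := fun y => by
    rw [eval_comp, eval_sub, show (C (1 / 2) - C (1 / 2) * X : ℝ[X]).eval y = (1 - y) / 2 by
      simp only [eval_sub, eval_mul, eval_C, eval_X]; ring]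
  have hnode : ∀ k ≤ n, |((q - p).comp (C (1 / 2) - C (1 / 2) * X)).eval
      (Real.cos (k * Real.pi / n))| ≤ ε := fun k hk => by
    have h1 := hpf (k + 1) (Finset.mem_Icc.mpr ⟨by omega, by omega⟩)
    rw [chebNode_succ, ← hn] at h1
    rw [heval, h1, abs_sub_comm]
    exact hfq _ ⟨by linarith [Real.cos_le_one (k * Real.pi / n)],
      by linarith [Real.neg_one_le_cos (k * Real.pi / n)]⟩
  have hqp := abs_eval_cos_le_of_abs_eval_node_le hn1 hdeg hnode
    (Real.arccos_nonneg (1 - 2 * t)) (Real.arccos_le_pi _)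
  rw [Real.cos_arccos (by linarith [ht.2]) (by linarith [ht.1]), heval,
    show (1 - (1 - 2 * t)) / 2 = t by ring] at hqp
  have hH := harmonic_two_pow_add_one_le (i - 1)
  rw [Nat.cast_sub (by omega), ← hn] at hH
  have hi' : (2 : ℝ) ≤ i := by exact_mod_cast hi
  have hscale : ε = c * 2 ^ s * ((2 : ℝ) ^ (i * s))⁻¹ * M := by
    have : (2 : ℝ) ^ (i * s) = (n : ℝ) ^ s * 2 ^ s := by
      rw [hn, ← mul_pow]
      push_cast
      rw [← pow_succ, Nat.sub_add_cancel (by omega), pow_mul]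
    rw [this, hε]
    field_simp
  calc |f t - p.eval t| ≤ |f t - q.eval t| + |q.eval t - p.eval t| := abs_sub_le _ _ _
    _ ≤ ε + 6 * (harmonic (n + 1) : ℝ) * ε := add_le_add (hfq t ht) hqp
    _ ≤ ε + 6 * (i + 1) * ε := by
        gcongr
        push_cast at hH
        linarith
    _ ≤ 13 * i * ε := by nlinarith
    _ = 13 * c * 2 ^ s * i * ((2 : ℝ) ^ (i * s))⁻¹ * M := by rw [hscale]; ring
end
end

section
/- Weighted least squares with iid random points achieves the best-approximation rate in L_2 with high probability: let α > 1/2 and β, C > 0. Then there exist b ∈ ℕ and c > 0, depending only on α, β, C, with the following property. Let μ be a Borel probability measure on a compact set D ⊆ ℝ^d, let (V_n)_{n∈ℕ} be subspaces of C(D) with dim V_n = n, and let F ⊆ C(D) satisfy sup_{f∈F} inf_{g∈V_n} ‖f − g‖_{L_2(μ)} ≤ C · n^{−α} (log n)^β for all n ≥ 2. Then for every n ≥ 2 there exists a measurable probability density ρ_n : D → (0,∞) with ∫_D ρ_n dμ = 1 (depending only on V_n and F) such that, if m := ⌈b·n·log n⌉ and x_1, …, x_m are independent random points each distributed according to the measure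 ρ_n·dμ, then with probability at least 1 − 1/(b n²) the following holds: for every f ∈ F, every g* ∈ V_n minimizing Σ_{k=1}^{m} ρ_n(x_k)^{−1} |f(x_k) − g(x_k)|² over g ∈ V_n satisfies ‖f − g*‖_{L_2(μ)} ≤ c · n^{−α} (log n)^β. -/
open MeasureTheory

noncomputable section

section MatrixMoments

open Matrix

variable {ι : Type*} [Fintype ι]

theorem dot_self_nonneg (y : ι → ℝ) : 0 ≤ y ⬝ᵥ y :=
  Finset.sum_nonneg fun _ _ => mul_self_nonneg _

variable [DecidableEq ι]

/-- The moments of a symmetric real matrix at a vector are the power sums of its eigenvalues against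
nonnegative weights. -/
theorem exists_spectral_weights {A : Matrix ι ι ℝ} (hA : A.IsHermitian) (y : ι → ℝ) :
    ∃ w : ι → ℝ, (∀ i, 0 ≤ w i) ∧
      ∀ k : ℕ, y ⬝ᵥ (A ^ k *ᵥ y) = ∑ i, w i * hA.eigenvalues i ^ k := by
  set U : Matrix ι ι ℝ := (hA.eigenvectorUnitary : Matrix ι ι ℝ) with hU
  refine ⟨fun i => (y ᵥ* U) i ^ 2, fun i => sq_nonneg _, fun k => ?_⟩
  have h : A ^ k = U * diagonal (fun i => hA.eigenvalues i ^ k) * Uᵀ := by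
    conv_lhs => rw [hA.spectral_theorem]
    rw [← map_pow, diagonal_pow, Unitary.conjStarAlgAut_apply]
    rfl
  rw [h, ← mulVec_mulVec, ← mulVec_mulVec, dotProduct_mulVec, mulVec_transpose]
  simp only [dotProduct, mulVec_diagonal]
  exact Finset.sum_congr rfl fun i _ => by ring

theorem le_eigenvalues {A : Matrix ι ι ℝ} (hA : A.IsHermitian) {a : ℝ}
    (h : ∀ v, a * (v ⬝ᵥ v) ≤ v ⬝ᵥ (A *ᵥ v)) (i : ι) : a ≤ hA.eigenvalues i := by
  have h1 := h (hA.eigenvectorBasis i)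
  have h2 : (hA.eigenvectorBasis i : ι → ℝ) ⬝ᵥ (hA.eigenvectorBasis i : ι → ℝ) = 1 := by
    have := hA.eigenvectorBasis.orthonormal.1 i
    rw [EuclideanSpace.norm_eq, Real.sqrt_eq_one] at this
    simpa [dotProduct, ← sq] using this
  rw [hA.mulVec_eigenvectorBasis, dotProduct_smul, h2] at h1
  simpa using h1

theorem eigenvalues_le {A : Matrix ι ι ℝ} (hA : A.IsHermitian) {a : ℝ}
    (h : ∀ v, v ⬝ᵥ (A *ᵥ v) ≤ a * (v ⬝ᵥ v)) (i : ι) : hA.eigenvalues i ≤ a := by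
  have h1 := h (hA.eigenvectorBasis i)
  have h2 : (hA.eigenvectorBasis i : ι → ℝ) ⬝ᵥ (hA.eigenvectorBasis i : ι → ℝ) = 1 := by
    have := hA.eigenvectorBasis.orthonormal.1 i
    rw [EuclideanSpace.norm_eq, Real.sqrt_eq_one] at this
    simpa [dotProduct, ← sq] using this
  rw [hA.mulVec_eigenvectorBasis, dotProduct_smul, h2] at h1
  simpa using h1

theorem moment_nonneg {A : Matrix ι ι ℝ} (hA : A.IsHermitian) {κ : ℝ} (hκ : 0 ≤ κ)
    (h : ∀ v, κ * (v ⬝ᵥ v) ≤ v ⬝ᵥ (A *ᵥ v)) (y : ι → ℝ) (k : ℕ) :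
    0 ≤ y ⬝ᵥ (A ^ k *ᵥ y) := by
  obtain ⟨w, hw, hm⟩ := exists_spectral_weights hA y
  rw [hm]
  exact Finset.sum_nonneg fun i _ =>
    mul_nonneg (hw i) (pow_nonneg (hκ.trans (le_eigenvalues hA h i)) _)

theorem moment_succ_ge {A : Matrix ι ι ℝ} (hA : A.IsHermitian) {κ : ℝ} (hκ : 0 ≤ κ)
    (h : ∀ v, κ * (v ⬝ᵥ v) ≤ v ⬝ᵥ (A *ᵥ v)) (y : ι → ℝ) (k : ℕ) :
    κ * (y ⬝ᵥ (A ^ k *ᵥ y)) ≤ y ⬝ᵥ (A ^ (k + 1) *ᵥ y) := by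
  obtain ⟨w, hw, hm⟩ := exists_spectral_weights hA y
  rw [hm, hm, Finset.mul_sum]
  refine Finset.sum_le_sum fun i _ => ?_
  have h1 := le_eigenvalues hA h i
  have h2 := mul_nonneg (hw i) (pow_nonneg (hκ.trans h1) k)
  calc κ * (w i * hA.eigenvalues i ^ k) ≤ hA.eigenvalues i * (w i * hA.eigenvalues i ^ k) := by
        gcongr
    _ = _ := by ring

theorem moment_succ_le {A : Matrix ι ι ℝ} (hA : A.IsHermitian) {κ c : ℝ} (hκ : 0 ≤ κ)
    (h : ∀ v, κ * (v ⬝ᵥ v) ≤ v ⬝ᵥ (A *ᵥ v)) (h' : ∀ v, v ⬝ᵥ (A *ᵥ v) ≤ c * (v ⬝ᵥ v))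
    (y : ι → ℝ) (k : ℕ) :
    y ⬝ᵥ (A ^ (k + 1) *ᵥ y) ≤ c * (y ⬝ᵥ (A ^ k *ᵥ y)) := by
  obtain ⟨w, hw, hm⟩ := exists_spectral_weights hA y
  rw [hm, hm, Finset.mul_sum]
  refine Finset.sum_le_sum fun i _ => ?_
  have h1 := le_eigenvalues hA h i
  have h2 := mul_nonneg (hw i) (pow_nonneg (hκ.trans h1) k)
  calc w i * hA.eigenvalues i ^ (k + 1) = hA.eigenvalues i * (w i * hA.eigenvalues i ^ k) := by
        ring
    _ ≤ _ := by gcongr; exact eigenvalues_le hA h' i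

/-- Chebyshev's sum inequality for the moments of a positive semidefinite matrix. -/
theorem moment_mul_moment_le {A : Matrix ι ι ℝ} (hA : A.IsHermitian) {κ : ℝ} (hκ : 0 ≤ κ)
    (h : ∀ v, κ * (v ⬝ᵥ v) ≤ v ⬝ᵥ (A *ᵥ v)) (y : ι → ℝ) (k l : ℕ) :
    (y ⬝ᵥ (A ^ k *ᵥ y)) * (y ⬝ᵥ (A ^ l *ᵥ y)) ≤ (y ⬝ᵥ y) * (y ⬝ᵥ (A ^ (k + l) *ᵥ y)) := by
  obtain ⟨w, hw, hm⟩ := exists_spectral_weights hA y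
  have h0 : y ⬝ᵥ y = ∑ i, w i := by simpa using hm 0
  have hl : ∀ i, 0 ≤ hA.eigenvalues i := fun i => hκ.trans (le_eigenvalues hA h i)
  have hmono : ∀ n : ℕ, Monovary (fun i => hA.eigenvalues i ^ n) hA.eigenvalues := fun n i j hij =>
    pow_le_pow_left₀ (hl i) hij.le n
  have key : 0 ≤ ∑ i, ∑ j, w i * w j * ((hA.eigenvalues i ^ k - hA.eigenvalues j ^ k) *
      (hA.eigenvalues i ^ l - hA.eigenvalues j ^ l)) := by
    refine Finset.sum_nonneg fun i _ => Finset.sum_nonneg fun j _ =>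
      mul_nonneg (mul_nonneg (hw i) (hw j)) ?_
    rcases le_total (hA.eigenvalues i) (hA.eigenvalues j) with hij | hij
    · exact mul_nonneg_of_nonpos_of_nonpos
        (sub_nonpos.2 (pow_le_pow_left₀ (hl i) hij k)) (sub_nonpos.2 (pow_le_pow_left₀ (hl i) hij l))
    · exact mul_nonneg
        (sub_nonneg.2 (pow_le_pow_left₀ (hl j) hij k)) (sub_nonneg.2 (pow_le_pow_left₀ (hl j) hij l))
  have expand : ∑ i, ∑ j, w i * w j * ((hA.eigenvalues i ^ k - hA.eigenvalues j ^ k) *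
      (hA.eigenvalues i ^ l - hA.eigenvalues j ^ l)) =
      2 * ((∑ i, w i) * ∑ i, w i * hA.eigenvalues i ^ (k + l)) -
      2 * ((∑ i, w i * hA.eigenvalues i ^ k) * ∑ i, w i * hA.eigenvalues i ^ l) := by
    have e1 : (∑ i, w i) * ∑ i, w i * hA.eigenvalues i ^ (k + l) =
        ∑ i, ∑ j, w i * (w j * hA.eigenvalues j ^ (k + l)) := Finset.sum_mul_sum _ _ _ _
    have e2 : (∑ i, w i) * ∑ i, w i * hA.eigenvalues i ^ (k + l) =
        ∑ i, ∑ j, w j * (w i * hA.eigenvalues i ^ (k + l)) := by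
      rw [mul_comm, Finset.sum_mul_sum]
      simp only [mul_comm]
    have e3 : (∑ i, w i * hA.eigenvalues i ^ k) * ∑ i, w i * hA.eigenvalues i ^ l =
        ∑ i, ∑ j, (w i * hA.eigenvalues i ^ k) * (w j * hA.eigenvalues j ^ l) :=
      Finset.sum_mul_sum _ _ _ _
    have e4 : (∑ i, w i * hA.eigenvalues i ^ k) * ∑ i, w i * hA.eigenvalues i ^ l =
        ∑ i, ∑ j, (w i * hA.eigenvalues i ^ l) * (w j * hA.eigenvalues j ^ k) := by
      rw [mul_comm, Finset.sum_mul_sum]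
    rw [two_mul, two_mul]
    conv_rhs =>
      congr
      · congr
        · rw [e1]
        · rw [e2]
      · congr
        · rw [e3]
        · rw [e4]
    simp only [← Finset.sum_add_distrib, ← Finset.sum_sub_distrib]
    refine Finset.sum_congr rfl fun i _ => Finset.sum_congr rfl fun j _ => ?_
    rw [pow_add, pow_add]; ring
  rw [hm, hm, hm, h0]
  linarith

/-- Jensen's inequality for the moments of a positive semidefinite matrix at a unit vector. -/
theorem pow_le_moment {A : Matrix ι ι ℝ} (hA : A.IsHermitian)
    (h : ∀ v, 0 ≤ v ⬝ᵥ (A *ᵥ v)) {y : ι → ℝ} (hy : y ⬝ᵥ y = 1) (k : ℕ) :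
    (y ⬝ᵥ (A *ᵥ y)) ^ k ≤ y ⬝ᵥ (A ^ k *ᵥ y) := by
  have h' : ∀ v, (0 : ℝ) * (v ⬝ᵥ v) ≤ v ⬝ᵥ (A *ᵥ v) := fun v => by simpa using h v
  induction k with
  | zero => simp [hy]
  | succ k ih =>
    have := moment_mul_moment_le hA le_rfl h' y k 1
    rw [hy, one_mul, pow_one] at this
    rw [pow_succ]
    exact (mul_le_mul_of_nonneg_right ih (h y)).trans this

theorem moment_le_trace {A : Matrix ι ι ℝ} (hA : A.IsHermitian)
    (h : ∀ v, 0 ≤ v ⬝ᵥ (A *ᵥ v)) {y : ι → ℝ} (hy : y ⬝ᵥ y = 1) :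
    y ⬝ᵥ (A *ᵥ y) ≤ A.trace := by
  set U : Matrix ι ι ℝ := (hA.eigenvectorUnitary : Matrix ι ι ℝ) with hU
  have hUU : U * Uᵀ = 1 := Unitary.coe_mul_star_self hA.eigenvectorUnitary
  have hl : ∀ i, 0 ≤ hA.eigenvalues i := le_eigenvalues hA (by simpa using h)
  have h1 : A = U * diagonal hA.eigenvalues * Uᵀ := by
    conv_lhs => rw [hA.spectral_theorem, Unitary.conjStarAlgAut_apply]
    rfl
  have h2 : A.trace = ∑ i, hA.eigenvalues i := by
    simpa using hA.trace_eq_sum_eigenvalues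
  have h3 : ∑ i, (y ᵥ* U) i ^ 2 = 1 := by
    have : (y ᵥ* U) ⬝ᵥ (y ᵥ* U) = 1 := by
      rw [← mulVec_transpose, dotProduct_mulVec, vecMul_mulVec, transpose_transpose, hUU,
        vecMul_one, hy]
    simpa [dotProduct, ← sq] using this
  have h4 : y ⬝ᵥ (A *ᵥ y) = ∑ i, hA.eigenvalues i * (y ᵥ* U) i ^ 2 := by
    conv_lhs => rw [h1]
    rw [← mulVec_mulVec, ← mulVec_mulVec, dotProduct_mulVec, mulVec_transpose]
    simp only [dotProduct, mulVec_diagonal]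
    exact Finset.sum_congr rfl fun i _ => by ring
  rw [h4, h2]
  refine Finset.sum_le_sum fun i _ => mul_le_of_le_one_right (hl i) ?_
  rw [← h3]
  exact Finset.single_le_sum (f := fun i => (y ᵥ* U) i ^ 2) (fun i _ => sq_nonneg _)
    (Finset.mem_univ i)

theorem pow_le_trace_pow {A : Matrix ι ι ℝ} (hA : A.IsHermitian)
    (h : ∀ v, 0 ≤ v ⬝ᵥ (A *ᵥ v)) {y : ι → ℝ} (hy : y ⬝ᵥ y = 1) (k : ℕ) :
    (y ⬝ᵥ (A *ᵥ y)) ^ k ≤ (A ^ k).trace :=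
  (pow_le_moment hA h hy k).trans <| moment_le_trace (hA.pow k)
    (fun v => moment_nonneg hA le_rfl (by simpa using h) v k) hy

theorem trace_eq_sum_moment (A : Matrix ι ι ℝ) :
    A.trace = ∑ i, Pi.single i 1 ⬝ᵥ (A *ᵥ Pi.single i 1) := by
  simp [Matrix.trace]

theorem trace_pow_nonneg {A : Matrix ι ι ℝ} (hA : A.IsHermitian) {κ : ℝ} (hκ : 0 ≤ κ)
    (h : ∀ v, κ * (v ⬝ᵥ v) ≤ v ⬝ᵥ (A *ᵥ v)) (k : ℕ) : 0 ≤ (A ^ k).trace := by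
  rw [trace_eq_sum_moment]
  exact Finset.sum_nonneg fun i _ => moment_nonneg hA hκ h _ _

theorem trace_pow_succ_ge {A : Matrix ι ι ℝ} (hA : A.IsHermitian) {κ : ℝ} (hκ : 0 ≤ κ)
    (h : ∀ v, κ * (v ⬝ᵥ v) ≤ v ⬝ᵥ (A *ᵥ v)) (k : ℕ) :
    κ * (A ^ k).trace ≤ (A ^ (k + 1)).trace := by
  rw [trace_eq_sum_moment, trace_eq_sum_moment (A ^ (k + 1)), Finset.mul_sum]
  exact Finset.sum_le_sum fun i _ => moment_succ_ge hA hκ h _ _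

theorem trace_pow_succ_le {A : Matrix ι ι ℝ} (hA : A.IsHermitian) {κ c : ℝ} (hκ : 0 ≤ κ)
    (h : ∀ v, κ * (v ⬝ᵥ v) ≤ v ⬝ᵥ (A *ᵥ v)) (h' : ∀ v, v ⬝ᵥ (A *ᵥ v) ≤ c * (v ⬝ᵥ v)) (k : ℕ) :
    (A ^ (k + 1)).trace ≤ c * (A ^ k).trace := by
  rw [trace_eq_sum_moment, trace_eq_sum_moment (A ^ k), Finset.mul_sum]
  exact Finset.sum_le_sum fun i _ => moment_succ_le hA hκ h h' _ _

/-! ### Rank-one perturbations -/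

/-- Mixed moments of a positive definite matrix and a rank-one perturbation of it. -/
theorem mixed_moment_bounds {A : Matrix ι ι ℝ} (hA : A.IsHermitian) {κ R : ℝ} (hκ : 0 < κ)
    (h : ∀ v, κ * (v ⬝ᵥ v) ≤ v ⬝ᵥ (A *ᵥ v)) {y : ι → ℝ} (hy : y ⬝ᵥ y ≤ R) (i b : ℕ) :
    y ⬝ᵥ (A ^ (b + i) *ᵥ y) ≤ y ⬝ᵥ ((A ^ b * (A + vecMulVec y y) ^ i) *ᵥ y) ∧
    y ⬝ᵥ ((A ^ b * (A + vecMulVec y y) ^ i) *ᵥ y) ≤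
      (1 + R / κ) ^ i * (y ⬝ᵥ (A ^ (b + i) *ᵥ y)) := by
  have hR : 0 ≤ R := (dot_self_nonneg y).trans hy
  induction i generalizing b with
  | zero => simp
  | succ i ih =>
    set T := A + vecMulVec y y with hT
    have step : y ⬝ᵥ ((A ^ b * T ^ (i + 1)) *ᵥ y) =
        y ⬝ᵥ ((A ^ (b + 1) * T ^ i) *ᵥ y) +
          (y ⬝ᵥ (A ^ b *ᵥ y)) * (y ⬝ᵥ ((A ^ 0 * T ^ i) *ᵥ y)) := by
      have : A ^ b * T ^ (i + 1) = A ^ (b + 1) * T ^ i + A ^ b * vecMulVec y y * T ^ i := by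
        rw [pow_succ' T, pow_succ A, hT]; noncomm_ring
      rw [this, add_mulVec, dotProduct_add, ← mulVec_mulVec, ← mulVec_mulVec, ← mulVec_mulVec,
        vecMulVec_mulVec, pow_zero, one_mul, mulVec_smul, dotProduct_smul]
      simp
    have p1 := ih (b + 1)
    have p0 := ih 0
    have n0 := moment_nonneg hA hκ.le h y b
    have n1 := moment_nonneg hA hκ.le h y i
    have n2 := moment_nonneg hA hκ.le h y (b + i)
    have c1 := moment_mul_moment_le hA hκ.le h y b i
    have c2 := moment_succ_ge hA hκ.le h y (b + i)
    have e : b + (i + 1) = b + 1 + i := by ring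
    have e' : b + i + 1 = b + 1 + i := by ring
    rw [zero_add] at p0
    rw [e'] at c2
    rw [step, e]
    constructor
    · have := mul_nonneg n0 (n1.trans p0.1)
      linarith [p1.1]
    · have hq : 0 ≤ (1 + R / κ) ^ i := by positivity
      have s1 := mul_le_mul_of_nonneg_left p0.2 n0
      have s2 := mul_le_mul_of_nonneg_left c1 hq
      have s3 := mul_le_mul_of_nonneg_left (mul_le_mul_of_nonneg_right hy n2) hq
      have s4 : R * (y ⬝ᵥ (A ^ (b + i) *ᵥ y)) ≤ R / κ * (y ⬝ᵥ (A ^ (b + 1 + i) *ᵥ y)) := by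
        calc _ = R / κ * (κ * (y ⬝ᵥ (A ^ (b + i) *ᵥ y))) := by field_simp
          _ ≤ _ := by gcongr
      have s5 := mul_le_mul_of_nonneg_left s4 hq
      rw [pow_succ (1 + R / κ)]
      linarith [p1.2]

theorem trace_pow_add_vecMulVec_bounds {A : Matrix ι ι ℝ} (hA : A.IsHermitian) {κ R : ℝ}
    (hκ : 0 < κ) (h : ∀ v, κ * (v ⬝ᵥ v) ≤ v ⬝ᵥ (A *ᵥ v)) {y : ι → ℝ} (hy : y ⬝ᵥ y ≤ R) (q : ℕ) :
    (A ^ (q + 1)).trace + (q + 1) * (y ⬝ᵥ (A ^ q *ᵥ y)) ≤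
        ((A + vecMulVec y y) ^ (q + 1)).trace ∧
    ((A + vecMulVec y y) ^ (q + 1)).trace ≤
      (A ^ (q + 1)).trace + (q + 1) * (1 + R / κ) ^ q * (y ⬝ᵥ (A ^ q *ᵥ y)) := by
  have hR : 0 ≤ R := (dot_self_nonneg y).trans hy
  set T := A + vecMulVec y y with hT
  have hψ := moment_nonneg hA hκ.le h y q
  have key : ∀ i b : ℕ, b + i = q + 1 →
      (A ^ (q + 1)).trace + i * (y ⬝ᵥ (A ^ q *ᵥ y)) ≤ (A ^ b * T ^ i).trace ∧
      (A ^ b * T ^ i).trace ≤ (A ^ (q + 1)).trace +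
        i * (1 + R / κ) ^ q * (y ⬝ᵥ (A ^ q *ᵥ y)) := by
    intro i
    induction i with
    | zero => intro b hb; simp only [add_zero] at hb; subst hb; simp
    | succ i ih =>
      intro b hb
      have hbi : b + i = q := by omega
      have step : (A ^ b * T ^ (i + 1)).trace = (A ^ (b + 1) * T ^ i).trace +
          y ⬝ᵥ ((A ^ b * T ^ i) *ᵥ y) := by
        have : A ^ b * T ^ (i + 1) = A ^ (b + 1) * T ^ i + A ^ b * (vecMulVec y y * T ^ i) := by
          rw [pow_succ' T, pow_succ A, hT]; noncomm_ring
        have hAT : Aᵀ = A := hA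
        have hTsym : (T ^ i)ᵀ = T ^ i := by
          rw [transpose_pow, hT, transpose_add, transpose_vecMulVec, hAT]
        have hAsym : (A ^ b)ᵀ = A ^ b := by rw [transpose_pow, hAT]
        have e1 : y ᵥ* T ^ i = T ^ i *ᵥ y := by rw [← mulVec_transpose, hTsym]
        have e2 : y ᵥ* A ^ b = A ^ b *ᵥ y := by rw [← mulVec_transpose, hAsym]
        rw [this, trace_add, vecMulVec_mul, mul_vecMulVec, trace_vecMulVec, ← mulVec_mulVec,
          dotProduct_mulVec y, e1, e2]
      have m := mixed_moment_bounds hA hκ h hy i b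
      rw [hbi] at m
      have p := ih (b + 1) (by omega)
      have hmono : (1 + R / κ) ^ i ≤ (1 + R / κ) ^ q :=
        pow_le_pow_right₀ (by have : 0 ≤ R / κ := by positivity
                              linarith) (by omega)
      have := mul_le_mul_of_nonneg_right hmono hψ
      rw [step]
      push_cast
      constructor
      · linarith [m.1, p.1]
      · linarith [m.2, p.2]
  simpa using key (q + 1) 0 (by simp)

end MatrixMoments

section RandomGram

open Matrix

variable {ι : Type*} [Fintype ι]

/-- The Gram matrix `∑ k, u k (u k)ᵀ` of a finite family of vectors. -/
def gramSum {n : ℕ} (u : Fin n → ι → ℝ) : Matrix ι ι ℝ := ∑ k, vecMulVec (u k) (u k)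

omit [Fintype ι] in
theorem gramSum_isHermitian {n : ℕ} (u : Fin n → ι → ℝ) : (gramSum u).IsHermitian := by
  change (gramSum u)ᵀ = gramSum u
  simp [gramSum, transpose_sum, transpose_vecMulVec]

theorem dotProduct_vecMulVec_mulVec (u v : ι → ℝ) :
    v ⬝ᵥ (vecMulVec u u *ᵥ v) = (u ⬝ᵥ v) ^ 2 := by
  rw [vecMulVec_mulVec, dotProduct_smul, dotProduct_comm v u]
  simp [sq]

theorem dotProduct_gramSum_mulVec {n : ℕ} (u : Fin n → ι → ℝ) (v : ι → ℝ) :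
    v ⬝ᵥ (gramSum u *ᵥ v) = ∑ k, (u k ⬝ᵥ v) ^ 2 := by
  simp only [gramSum, sum_mulVec, dotProduct_sum, dotProduct_vecMulVec_mulVec]

omit [Fintype ι] in
theorem gramSum_cons {n : ℕ} (x : ι → ℝ) (u : Fin n → ι → ℝ) :
    gramSum (Fin.cons x u : Fin (n + 1) → ι → ℝ) = vecMulVec x x + gramSum u := by
  simp [gramSum, Fin.sum_univ_succ]

theorem sq_dotProduct_le (u v : ι → ℝ) : (u ⬝ᵥ v) ^ 2 ≤ (u ⬝ᵥ u) * (v ⬝ᵥ v) := by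
  simpa [dotProduct, ← sq] using Finset.sum_mul_sq_le_sq_mul_sq Finset.univ u v

variable [DecidableEq ι]

theorem continuous_trace_pow_gramSum {n : ℕ} (A : Matrix ι ι ℝ) (s : ℝ) (p : ℕ) :
    Continuous fun u : Fin n → ι → ℝ => ((A + s • gramSum u) ^ p).trace := by
  refine Continuous.matrix_trace ?_
  refine Continuous.pow ?_ p
  refine continuous_const.add (Continuous.const_smul ?_ s)
  refine continuous_finsetSum _ fun k _ => ?_
  exact Continuous.matrix_vecMulVec (by fun_prop) (by fun_prop)

variable {X : Type*} [MeasurableSpace X] {ν : Measure X} [IsProbabilityMeasure ν]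

omit [DecidableEq ι] [Fintype ι] in
theorem lintegral_pi_fin_succ {n : ℕ} {f : (Fin (n + 1) → X) → ENNReal} (hf : Measurable f) :
    ∫⁻ χ, f χ ∂(Measure.pi fun _ : Fin (n + 1) => ν) =
      ∫⁻ x, ∫⁻ χ, f (Fin.cons x χ) ∂(Measure.pi fun _ : Fin n => ν) ∂ν := by
  have mp := (measurePreserving_piFinSuccAbove (fun _ : Fin (n + 1) => ν) 0).symm
  rw [← mp.lintegral_comp hf, lintegral_prod (fun z => f _) (hf.comp mp.measurable).aemeasurable]
  simp [MeasurableEquiv.piFinSuccAbove, Fin.insertNthEquiv, Fin.insertNth_zero']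

variable {y : X → ι → ℝ} {R δ : ℝ}

omit [DecidableEq ι] in
theorem integrable_coord_mul (hm : Measurable y) (hR : ∀ x, y x ⬝ᵥ y x ≤ R) (i j : ι) :
    Integrable (fun x => y x i * y x j) ν := by
  refine Integrable.of_bound (C := R) (by fun_prop) (.of_forall fun x => ?_)
  have h : ∀ i, y x i ^ 2 ≤ R := fun i => le_trans (by
    simpa [dotProduct, ← sq] using
      Finset.single_le_sum (f := fun i => y x i ^ 2) (fun i _ => sq_nonneg _) (Finset.mem_univ i))
      (hR x)
  rw [Real.norm_eq_abs, abs_le]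
  constructor <;> nlinarith [h i, h j, sq_nonneg (y x i + y x j), sq_nonneg (y x i - y x j)]

omit [DecidableEq ι] in
theorem dotProduct_mulVec_eq_sum (M : Matrix ι ι ℝ) (v : ι → ℝ) :
    v ⬝ᵥ (M *ᵥ v) = ∑ i, ∑ j, M i j * (v i * v j) := by
  simp only [dotProduct, mulVec, Finset.mul_sum]
  exact Finset.sum_congr rfl fun i _ => Finset.sum_congr rfl fun j _ => by ring

omit [DecidableEq ι] in
theorem integrable_quadratic (hm : Measurable y) (hR : ∀ x, y x ⬝ᵥ y x ≤ R) (M : Matrix ι ι ℝ) :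
    Integrable (fun x => y x ⬝ᵥ (M *ᵥ y x)) ν := by
  simp only [dotProduct_mulVec_eq_sum]
  exact integrable_finsetSum _ fun i _ => integrable_finsetSum _ fun j _ =>
    (integrable_coord_mul hm hR i j).const_mul _

theorem integral_quadratic (hm : Measurable y) (hR : ∀ x, y x ⬝ᵥ y x ≤ R)
    (hcov : ∀ i j, ∫ x, y x i * y x j ∂ν = if i = j then δ else 0) (M : Matrix ι ι ℝ) :
    ∫ x, y x ⬝ᵥ (M *ᵥ y x) ∂ν = δ * M.trace := by
  simp only [dotProduct_mulVec_eq_sum]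
  have e : ∀ i, ∫ x, ∑ j, M i j * (y x i * y x j) ∂ν = ∑ j, M i j * if i = j then δ else 0 := by
    intro i
    rw [integral_finsetSum]
    · simp only [integral_const_mul, hcov]
    · exact fun j _ => (integrable_coord_mul hm hR i j).const_mul _
  rw [integral_finsetSum]
  · simp only [e]
    simp [Matrix.trace, Finset.mul_sum, mul_comm]
  · exact fun i _ => integrable_finsetSum _ fun j _ =>
      (integrable_coord_mul hm hR i j).const_mul _

/-- Growth of the trace moments of a sum of independent rank-one matrices. -/
theorem lintegral_trace_pow_add_gramSum_le (hm : Measurable y) (hR : ∀ x, y x ⬝ᵥ y x ≤ R)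
    (hδ : 0 ≤ δ) (hcov : ∀ i j, ∫ x, y x i * y x j ∂ν = if i = j then δ else 0)
    {κ : ℝ} (hκ : 0 < κ) (q n : ℕ) {A : Matrix ι ι ℝ} (hA : A.IsHermitian)
    (h : ∀ v, κ * (v ⬝ᵥ v) ≤ v ⬝ᵥ (A *ᵥ v)) :
    ∫⁻ χ, ENNReal.ofReal (((A + gramSum fun k => y (χ k)) ^ (q + 1)).trace)
        ∂(Measure.pi fun _ : Fin n => ν) ≤
      ENNReal.ofReal ((A ^ (q + 1)).trace *
        (1 + (q + 1) * (1 + R / κ) ^ q * δ / κ) ^ n) := by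
  have hR0 : 0 ≤ R := by
    obtain ⟨x⟩ := nonempty_of_isProbabilityMeasure ν
    exact (dot_self_nonneg _).trans (hR x)
  set g := 1 + (q + 1) * (1 + R / κ) ^ q * δ / κ with hg
  have hg0 : 0 ≤ g := by positivity
  induction n generalizing A with
  | zero => simp [gramSum]
  | succ n ih =>
    have meas : Measurable fun χ : Fin (n + 1) → X =>
        ENNReal.ofReal (((A + gramSum fun k => y (χ k)) ^ (q + 1)).trace) := by
      refine ENNReal.measurable_ofReal.comp ?_
      have := (continuous_trace_pow_gramSum (n := n + 1) A 1 (q + 1)).measurable.comp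
        (measurable_pi_lambda (fun (χ : Fin (n + 1) → X) k => y (χ k)) fun k =>
          hm.comp (measurable_pi_apply k))
      simpa [Function.comp_def] using this
    rw [lintegral_pi_fin_succ meas]
    have step : ∀ x, ∫⁻ χ, ENNReal.ofReal (((A + gramSum fun k =>
          y ((Fin.cons x χ : Fin (n + 1) → X) k)) ^ (q + 1)).trace)
          ∂(Measure.pi fun _ : Fin n => ν) ≤
        ENNReal.ofReal (((A ^ (q + 1)).trace +
          (q + 1) * (1 + R / κ) ^ q * (y x ⬝ᵥ (A ^ q *ᵥ y x))) * g ^ n) := by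
      intro x
      have e : ∀ χ : Fin n → X, A + gramSum (fun k => y ((Fin.cons x χ : Fin (n + 1) → X) k)) =
          (A + vecMulVec (y x) (y x)) + gramSum fun k => y (χ k) := fun χ => by
        rw [add_assoc, ← gramSum_cons]
        congr 2
        ext k : 1
        refine Fin.cases ?_ (fun k => ?_) k <;> simp
      simp only [e]
      refine (ih (A := A + vecMulVec (y x) (y x)) ?_ fun v => ?_).trans ?_
      · have hAT : Aᵀ = A := hA
        change (A + vecMulVec (y x) (y x))ᵀ = _
        rw [transpose_add, transpose_vecMulVec, hAT]
      · rw [add_mulVec, dotProduct_add, dotProduct_vecMulVec_mulVec]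
        linarith [h v, sq_nonneg (y x ⬝ᵥ v)]
      · exact ENNReal.ofReal_le_ofReal (mul_le_mul_of_nonneg_right
          (trace_pow_add_vecMulVec_bounds hA hκ h (hR x) q).2 (pow_nonneg hg0 n))
    refine (lintegral_mono step).trans ?_
    have int : Integrable (fun x => ((A ^ (q + 1)).trace +
          (q + 1) * (1 + R / κ) ^ q * (y x ⬝ᵥ (A ^ q *ᵥ y x))) * g ^ n) ν :=
      ((integrable_const _).add ((integrable_quadratic hm hR _).const_mul _)).mul_const _
    have tr0 := trace_pow_nonneg hA hκ.le h (q + 1)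
    rw [← ofReal_integral_eq_lintegral_ofReal int (.of_forall fun x => mul_nonneg (add_nonneg tr0
      (mul_nonneg (by positivity) (moment_nonneg hA hκ.le h _ _))) (pow_nonneg hg0 n))]
    refine ENNReal.ofReal_le_ofReal ?_
    rw [integral_mul_const, integral_add (integrable_const _)
      ((integrable_quadratic hm hR _).const_mul _), integral_const_mul,
      integral_quadratic hm hR hcov]
    simp only [integral_const, probReal_univ, one_smul]
    rw [pow_succ' g, ← mul_assoc (A ^ (q + 1)).trace]
    refine mul_le_mul_of_nonneg_right ?_ (pow_nonneg hg0 n)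
    have t := trace_pow_succ_ge hA hκ.le h q
    have t' : (A ^ q).trace ≤ (A ^ (q + 1)).trace / κ := by
      rw [le_div_iff₀ hκ]; linarith
    calc _ ≤ (A ^ (q + 1)).trace + (q + 1) * (1 + R / κ) ^ q * (δ * ((A ^ (q + 1)).trace / κ)) := by
          gcongr
      _ = _ := by rw [hg]; ring

/-- Decay of the trace moments of a multiple of the identity minus a sum of independent rank-one
matrices. -/
theorem lintegral_trace_pow_sub_gramSum_le (hm : Measurable y) (hR : ∀ x, y x ⬝ᵥ y x ≤ R)
    (hδ : 0 ≤ δ) (hcov : ∀ i j, ∫ x, y x i * y x j ∂ν = if i = j then δ else 0)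
    {κ c : ℝ} (hκ : 0 < κ) (q n : ℕ) {A : Matrix ι ι ℝ} (hA : A.IsHermitian)
    (h : ∀ v, (κ + n * R) * (v ⬝ᵥ v) ≤ v ⬝ᵥ (A *ᵥ v))
    (h' : ∀ v, v ⬝ᵥ (A *ᵥ v) ≤ c * (v ⬝ᵥ v)) (hc : 0 < c) :
    ∫⁻ χ, ENNReal.ofReal (((A - gramSum fun k => y (χ k)) ^ (q + 1)).trace)
        ∂(Measure.pi fun _ : Fin n => ν) ≤
      ENNReal.ofReal ((A ^ (q + 1)).trace *
        Real.exp (-((q + 1) * δ / (c * (1 + R / κ) ^ q))) ^ n) := by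
  have hR0 : 0 ≤ R := by
    obtain ⟨x⟩ := nonempty_of_isProbabilityMeasure ν
    exact (dot_self_nonneg _).trans (hR x)
  set g := Real.exp (-((q + 1) * δ / (c * (1 + R / κ) ^ q))) with hg
  have hg0 : 0 ≤ g := Real.exp_nonneg _
  induction n generalizing A with
  | zero => simp [gramSum]
  | succ n ih =>
    have meas : Measurable fun χ : Fin (n + 1) → X =>
        ENNReal.ofReal (((A - gramSum fun k => y (χ k)) ^ (q + 1)).trace) := by
      refine ENNReal.measurable_ofReal.comp ?_
      have := (continuous_trace_pow_gramSum (n := n + 1) A (-1) (q + 1)).measurable.comp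
        (measurable_pi_lambda (fun (χ : Fin (n + 1) → X) k => y (χ k)) fun k =>
          hm.comp (measurable_pi_apply k))
      simpa [Function.comp_def, sub_eq_add_neg] using this
    rw [lintegral_pi_fin_succ meas]
    have hκA : ∀ v, κ * (v ⬝ᵥ v) ≤ v ⬝ᵥ (A *ᵥ v) := fun v => by
      have : 0 ≤ ((n + 1 : ℕ) : ℝ) * R * (v ⬝ᵥ v) :=
        mul_nonneg (by positivity) (dot_self_nonneg v)
      linarith [h v]
    set K := (1 + R / κ) ^ q with hK
    have hK0 : 0 < K := by positivity
    have pert : ∀ x, (A - vecMulVec (y x) (y x)).IsHermitian ∧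
        (∀ v, (κ + n * R) * (v ⬝ᵥ v) ≤ v ⬝ᵥ ((A - vecMulVec (y x) (y x)) *ᵥ v)) ∧
        (∀ v, v ⬝ᵥ ((A - vecMulVec (y x) (y x)) *ᵥ v) = v ⬝ᵥ (A *ᵥ v) - (y x ⬝ᵥ v) ^ 2) ∧
        0 ≤ ((A - vecMulVec (y x) (y x)) ^ (q + 1)).trace ∧
        ((A - vecMulVec (y x) (y x)) ^ (q + 1)).trace ≤
          (A ^ (q + 1)).trace - (q + 1) / K * (y x ⬝ᵥ (A ^ q *ᵥ y x)) := by
      intro x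
      set B := A - vecMulVec (y x) (y x) with hB
      have hBA : B + vecMulVec (y x) (y x) = A := by rw [hB]; abel
      have hBh : B.IsHermitian := by
        have hAT : Aᵀ = A := hA
        change (A - vecMulVec (y x) (y x))ᵀ = _
        rw [transpose_sub, transpose_vecMulVec, hAT]
      have hquad : ∀ v, v ⬝ᵥ (B *ᵥ v) = v ⬝ᵥ (A *ᵥ v) - (y x ⬝ᵥ v) ^ 2 := fun v => by
        rw [hB, sub_mulVec, dotProduct_sub, dotProduct_vecMulVec_mulVec]
      have hBl : ∀ v, (κ + n * R) * (v ⬝ᵥ v) ≤ v ⬝ᵥ (B *ᵥ v) := fun v => by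
        have h1 := sq_dotProduct_le (y x) v
        have h2 := mul_le_mul_of_nonneg_right (hR x) (dot_self_nonneg v)
        have h3 := h v
        push_cast at h3
        rw [hquad]
        linarith
      have hBκ : ∀ v, κ * (v ⬝ᵥ v) ≤ v ⬝ᵥ (B *ᵥ v) := fun v => by
        have : 0 ≤ (n : ℝ) * R * (v ⬝ᵥ v) := mul_nonneg (by positivity) (dot_self_nonneg v)
        linarith [hBl v]
      have t := (trace_pow_add_vecMulVec_bounds hBh hκ hBκ (hR x) q).1
      have m := (mixed_moment_bounds hBh hκ hBκ (hR x) q 0).2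
      rw [hBA] at t m
      rw [pow_zero, one_mul, zero_add, ← hK, ← div_le_iff₀' hK0] at m
      have := mul_le_mul_of_nonneg_left m (by positivity : (0 : ℝ) ≤ q + 1)
      have e2 : (q + 1 : ℝ) / K * (y x ⬝ᵥ (A ^ q *ᵥ y x)) =
        (q + 1) * ((y x ⬝ᵥ (A ^ q *ᵥ y x)) / K) := by ring
      exact ⟨hBh, hBl, hquad, trace_pow_nonneg hBh hκ.le hBκ _, by rw [e2]; linarith⟩
    have step : ∀ x, ∫⁻ χ, ENNReal.ofReal (((A - gramSum fun k =>
          y ((Fin.cons x χ : Fin (n + 1) → X) k)) ^ (q + 1)).trace)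
          ∂(Measure.pi fun _ : Fin n => ν) ≤
        ENNReal.ofReal (((A ^ (q + 1)).trace -
          (q + 1) / K * (y x ⬝ᵥ (A ^ q *ᵥ y x))) * g ^ n) := by
      intro x
      obtain ⟨hBh, hBl, hquad, -, hB⟩ := pert x
      have e : ∀ χ : Fin n → X, A - gramSum (fun k => y ((Fin.cons x χ : Fin (n + 1) → X) k)) =
          (A - vecMulVec (y x) (y x)) - gramSum fun k => y (χ k) := fun χ => by
        rw [sub_sub, ← gramSum_cons]
        congr 2
        ext k : 1
        refine Fin.cases ?_ (fun k => ?_) k <;> simp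
      simp only [e]
      refine (ih (A := A - vecMulVec (y x) (y x)) hBh hBl fun v => ?_).trans ?_
      · rw [hquad]
        linarith [h' v, sq_nonneg (y x ⬝ᵥ v)]
      · exact ENNReal.ofReal_le_ofReal (mul_le_mul_of_nonneg_right hB (pow_nonneg hg0 n))
    refine (lintegral_mono step).trans ?_
    have int0 : Integrable (fun x => (q + 1) / K * (y x ⬝ᵥ (A ^ q *ᵥ y x))) ν :=
      (integrable_quadratic hm hR _).const_mul _
    have int : Integrable (fun x => ((A ^ (q + 1)).trace -
          (q + 1) / K * (y x ⬝ᵥ (A ^ q *ᵥ y x))) * g ^ n) ν :=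
      ((integrable_const _).sub int0).mul_const _
    have nonneg : ∀ x, 0 ≤ ((A ^ (q + 1)).trace -
        (q + 1) / K * (y x ⬝ᵥ (A ^ q *ᵥ y x))) * g ^ n := by
      intro x
      obtain ⟨-, -, -, h1, h2⟩ := pert x
      exact mul_nonneg (h1.trans h2) (pow_nonneg hg0 n)
    rw [← ofReal_integral_eq_lintegral_ofReal int (.of_forall nonneg)]
    refine ENNReal.ofReal_le_ofReal ?_
    rw [integral_mul_const, integral_sub (integrable_const _) int0, integral_const_mul,
      integral_quadratic hm hR hcov]
    simp only [integral_const, probReal_univ, one_smul]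
    rw [pow_succ' g, ← mul_assoc (A ^ (q + 1)).trace]
    refine mul_le_mul_of_nonneg_right ?_ (pow_nonneg hg0 n)
    have t := trace_pow_succ_le hA hκ.le hκA h' q
    have t' : (A ^ (q + 1)).trace / c ≤ (A ^ q).trace := by
      rw [div_le_iff₀ hc]; linarith
    have tr0 := trace_pow_nonneg hA hκ.le hκA (q + 1)
    have hexp : 1 - (q + 1) * δ / (c * K) ≤ g := by
      have := Real.add_one_le_exp (-((q + 1) * δ / (c * K)))
      linarith
    calc _ ≤ (A ^ (q + 1)).trace - (q + 1) / K * (δ * ((A ^ (q + 1)).trace / c)) := by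
          gcongr
      _ = (A ^ (q + 1)).trace * (1 - (q + 1) * δ / (c * K)) := by field_simp
      _ ≤ _ := by gcongr

end RandomGram

section RandomGramTails

open Matrix

variable {ι : Type*} [Fintype ι] [DecidableEq ι]

theorem pow_le_trace_pow_of_le {A : Matrix ι ι ℝ} (hA : A.IsHermitian)
    (h : ∀ v, 0 ≤ v ⬝ᵥ (A *ᵥ v)) {v : ι → ℝ} (hv : 0 < v ⬝ᵥ v) {s : ℝ} (hs : 0 ≤ s)
    (hsv : s * (v ⬝ᵥ v) ≤ v ⬝ᵥ (A *ᵥ v)) (k : ℕ) : s ^ k ≤ (A ^ k).trace := by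
  set a := √(v ⬝ᵥ v) with ha
  have ha0 : 0 < a := Real.sqrt_pos.2 hv
  have haa : v ⬝ᵥ v = a * a := (Real.mul_self_sqrt hv.le).symm
  have h1 : (a⁻¹ • v) ⬝ᵥ (a⁻¹ • v) = 1 := by
    rw [smul_dotProduct, dotProduct_smul, haa]
    simp only [smul_eq_mul]
    field_simp
  refine le_trans (pow_le_pow_left₀ hs ?_ k) (pow_le_trace_pow hA h h1 k)
  rw [mulVec_smul, smul_dotProduct, dotProduct_smul]
  simp only [smul_eq_mul]
  rw [haa] at hsv
  calc s = a⁻¹ * (a⁻¹ * (s * (a * a))) := by field_simp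
    _ ≤ _ := by gcongr

variable {X : Type*} [MeasurableSpace X] {ν : Measure X} [IsProbabilityMeasure ν]
  {y : X → ι → ℝ} {R : ℝ}

omit [IsProbabilityMeasure ν] in
/-- Markov's inequality for trace moments. -/
theorem measure_le_of_trace_pow {n : ℕ} (hm : Measurable y) (A : Matrix ι ι ℝ) (s : ℝ) (p : ℕ)
    {S : Set (Fin n → X)} {t B P : ℝ} (ht : 0 < t)
    (hS : ∀ χ ∈ S, t ≤ ((A + s • gramSum fun k => y (χ k)) ^ p).trace)
    (hB : ∫⁻ χ, ENNReal.ofReal (((A + s • gramSum fun k => y (χ k)) ^ p).trace)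
      ∂(Measure.pi fun _ : Fin n => ν) ≤ ENNReal.ofReal B) (hBP : B ≤ t * P) :
    (Measure.pi fun _ : Fin n => ν) S ≤ ENNReal.ofReal P := by
  have meas : Measurable fun χ : Fin n → X =>
      ENNReal.ofReal (((A + s • gramSum fun k => y (χ k)) ^ p).trace) :=
    ENNReal.measurable_ofReal.comp <|
      (continuous_trace_pow_gramSum (n := n) A s p).measurable.comp
        (measurable_pi_lambda (fun (χ : Fin n → X) k => y (χ k)) fun k =>
          hm.comp (measurable_pi_apply k))
  have h1 := mul_meas_ge_le_lintegral (μ := Measure.pi fun _ : Fin n => ν) meas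
    (ENNReal.ofReal t)
  have h2 : S ⊆ {χ | ENNReal.ofReal t ≤
      ENNReal.ofReal (((A + s • gramSum fun k => y (χ k)) ^ p).trace)} :=
    fun χ hχ => ENNReal.ofReal_le_ofReal (hS χ hχ)
  have h3 : ENNReal.ofReal t * (Measure.pi fun _ : Fin n => ν) S ≤
      ENNReal.ofReal t * ENNReal.ofReal P := by
    rw [← ENNReal.ofReal_mul ht.le]
    exact ((mul_le_mul_right (measure_mono h2) _).trans h1).trans
      (hB.trans (ENNReal.ofReal_le_ofReal hBP))
  exact (ENNReal.mul_le_mul_iff_right (ENNReal.ofReal_pos.2 ht).ne' ENNReal.ofReal_ne_top).1 h3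

theorem trace_smul_one_pow (c : ℝ) (p : ℕ) :
    (((c • 1 : Matrix ι ι ℝ)) ^ p).trace = c ^ p * Fintype.card ι := by
  rw [smul_pow, one_pow, trace_smul, trace_one, smul_eq_mul]

omit [Fintype ι] in
theorem isHermitian_smul_one (c : ℝ) : ((c • 1 : Matrix ι ι ℝ)).IsHermitian := by
  change (c • 1 : Matrix ι ι ℝ)ᵀ = _
  simp

theorem dotProduct_smul_one_mulVec (c : ℝ) (v : ι → ℝ) :
    v ⬝ᵥ ((c • 1 : Matrix ι ι ℝ) *ᵥ v) = c * (v ⬝ᵥ v) := by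
  rw [smul_mulVec, one_mulVec, dotProduct_smul, smul_eq_mul]

/-- Upper tail bound for a sum of independent rank-one quadratic forms. -/
theorem measure_exists_quadratic_gt_le (hm : Measurable y) (hR : ∀ x, y x ⬝ᵥ y x ≤ R)
    {m : ℕ} (hm0 : 0 < m)
    (hcov : ∀ i j, ∫ x, y x i * y x j ∂ν = if i = j then (1 / m : ℝ) else 0)
    (hR0 : 0 < R) {p : ℕ} (hp : 8 ≤ p * R) :
    (Measure.pi fun _ : Fin m => ν)
        {χ | ∃ v, p * R * (v ⬝ᵥ v) < ∑ k, (y (χ k) ⬝ᵥ v) ^ 2} ≤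
      ENNReal.ofReal (Fintype.card ι * Real.exp (-(p / 3))) := by
  obtain ⟨q, rfl⟩ : ∃ q, p = q + 1 := Nat.exists_eq_succ_of_ne_zero (by
    rintro rfl
    norm_num at hp)
  set p := q + 1 with hpq
  have hp0 : (0 : ℝ) < p := by positivity
  have hpq' : (p : ℝ) = q + 1 := by push_cast [hpq]; rfl
  set κ := p * R with hκ
  have hκ0 : 0 < κ := by positivity
  have hm0' : (0 : ℝ) < m := by exact_mod_cast hm0
  have main := lintegral_trace_pow_add_gramSum_le hm hR (by positivity) hcov hκ0 q m
    (isHermitian_smul_one κ) fun v => (dotProduct_smul_one_mulVec κ v).ge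
  rw [trace_smul_one_pow] at main
  refine measure_le_of_trace_pow hm (κ • 1) 1 p (t := (2 * κ) ^ p) (by positivity) ?_
    (by simpa only [one_smul] using main) ?_
  · rintro χ ⟨v, hv⟩
    have hv0 : 0 < v ⬝ᵥ v := by
      refine lt_of_le_of_ne (dot_self_nonneg v) fun h0 => ?_
      rw [eq_comm, dotProduct_self_eq_zero] at h0
      simp [h0] at hv
    rw [one_smul]
    have quad : ∀ v, v ⬝ᵥ ((κ • 1 + gramSum fun k => y (χ k)) *ᵥ v) =
        κ * (v ⬝ᵥ v) + ∑ k, (y (χ k) ⬝ᵥ v) ^ 2 := fun v => by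
      rw [add_mulVec, dotProduct_add, dotProduct_smul_one_mulVec, dotProduct_gramSum_mulVec]
    refine pow_le_trace_pow_of_le ((isHermitian_smul_one κ).add (gramSum_isHermitian _))
      (fun v => ?_) hv0 (by positivity) ?_ p
    · rw [quad]
      have := dot_self_nonneg v
      positivity
    · rw [quad]
      linarith
  · have e1 : (1 + R / κ) ^ q ≤ Real.exp 1 := by
      have : R / κ = 1 / p := by rw [hκ]; field_simp
      calc (1 + R / κ) ^ q ≤ Real.exp (1 / p) ^ q := by
            rw [this]
            gcongr
            linarith [Real.add_one_le_exp (1 / p : ℝ)]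
        _ = Real.exp (q * (1 / p)) := (Real.exp_nat_mul _ _).symm
        _ ≤ Real.exp 1 := by
            gcongr
            rw [mul_one_div, div_le_one hp0, hpq']
            linarith
    have e2 : (1 + (q + 1) * (1 + R / κ) ^ q * (1 / m) / κ) ^ m ≤
        Real.exp (p * (Real.exp 1 / 8)) := by
      calc _ ≤ Real.exp ((q + 1) * (1 + R / κ) ^ q * (1 / m) / κ) ^ m := by
            gcongr
            linarith [Real.add_one_le_exp ((q + 1) * (1 + R / κ) ^ q * (1 / m) / κ : ℝ)]
        _ = Real.exp (m * ((q + 1) * (1 + R / κ) ^ q * (1 / m) / κ)) :=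
            (Real.exp_nat_mul _ _).symm
        _ ≤ _ := by
            rw [← hpq', Real.exp_le_exp]
            calc m * (p * (1 + R / κ) ^ q * (1 / m) / κ) = p * ((1 + R / κ) ^ q / κ) := by
                  field_simp
              _ ≤ _ := by gcongr
    have e3 : Real.exp (p * (Real.exp 1 / 8)) ≤ 2 ^ p * Real.exp (-(p / 3)) := by
      rw [← Real.exp_log (two_pos : (0 : ℝ) < 2), ← Real.exp_nat_mul, ← Real.exp_add,
        Real.exp_le_exp]
      have := Real.exp_one_lt_d9
      have := Real.log_two_gt_d9
      nlinarith
    calc _ ≤ κ ^ p * Fintype.card ι * (2 ^ p * Real.exp (-(p / 3))) := by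
          gcongr
          exact e2.trans e3
      _ = _ := by rw [mul_pow]; ring

/-- Lower tail bound for a sum of independent rank-one quadratic forms. -/
theorem measure_exists_quadratic_lt_le (hm : Measurable y) (hR : ∀ x, y x ⬝ᵥ y x ≤ R)
    {m : ℕ} (hm0 : 0 < m)
    (hcov : ∀ i j, ∫ x, y x i * y x j ∂ν = if i = j then (1 / m : ℝ) else 0)
    (hR0 : 0 < R) :
    (Measure.pi fun _ : Fin m => ν)
        {χ | ∃ v, ∑ k, (y (χ k) ⬝ᵥ v) ^ 2 < 1 / 2 * (v ⬝ᵥ v)} ≤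
      ENNReal.ofReal (Fintype.card ι * Real.exp (-(3 / (200 * R)))) := by
  obtain ⟨q, hq⟩ := exists_nat_ge (max (m : ℝ) (1 / R))
  have hqm := (le_max_left _ _).trans hq
  have hqR := (le_max_right _ _).trans hq
  set p := q + 1 with hpq
  have hp0 : (0 : ℝ) < p := by positivity
  have hpq' : (p : ℝ) = q + 1 := by push_cast [hpq]; rfl
  have hm0' : (0 : ℝ) < m := by exact_mod_cast hm0
  rw [div_le_iff₀ hR0] at hqR
  set c := 20 * R * p with hc
  have hc3 : 3 ≤ c := by rw [hc, hpq']; nlinarith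
  have hκ0 : 0 < c / 2 := by positivity
  have hmR : m * R ≤ c / 2 := by rw [hc, hpq']; nlinarith
  have main := lintegral_trace_pow_sub_gramSum_le hm hR (by positivity) hcov hκ0 q m
    (isHermitian_smul_one c) (fun v => by
      rw [dotProduct_smul_one_mulVec]
      exact mul_le_mul_of_nonneg_right (by linarith) (dot_self_nonneg v))
    (fun v => (dotProduct_smul_one_mulVec c v).le) (by positivity)
  rw [trace_smul_one_pow] at main
  refine measure_le_of_trace_pow hm (c • 1) (-1) p (t := (c - 1 / 2) ^ p)
    (pow_pos (by linarith) p) ?_ (by simpa only [neg_one_smul, ← sub_eq_add_neg] using main) ?_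
  · rintro χ ⟨v, hv⟩
    have hv0 : 0 < v ⬝ᵥ v := by
      refine lt_of_le_of_ne (dot_self_nonneg v) fun h0 => ?_
      rw [eq_comm, dotProduct_self_eq_zero] at h0
      simp [h0] at hv
    rw [neg_one_smul, ← sub_eq_add_neg]
    have quad : ∀ v, v ⬝ᵥ ((c • 1 - gramSum fun k => y (χ k)) *ᵥ v) =
        c * (v ⬝ᵥ v) - ∑ k, (y (χ k) ⬝ᵥ v) ^ 2 := fun v => by
      rw [sub_mulVec, dotProduct_sub, dotProduct_smul_one_mulVec, dotProduct_gramSum_mulVec]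
    refine pow_le_trace_pow_of_le ((isHermitian_smul_one c).sub (gramSum_isHermitian _))
      (fun v => ?_) hv0 (by linarith) ?_ p
    · rw [quad]
      have h0 := dot_self_nonneg v
      have h1 : ∑ k, (y (χ k) ⬝ᵥ v) ^ 2 ≤ ∑ _k : Fin m, R * (v ⬝ᵥ v) :=
        Finset.sum_le_sum fun k _ => (sq_dotProduct_le _ v).trans
          (mul_le_mul_of_nonneg_right (hR _) h0)
      simp only [Finset.sum_const, Finset.card_univ, Fintype.card_fin, nsmul_eq_mul] at h1
      nlinarith
    · rw [quad]
      linarith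
  · have e1 : (1 + R / (c / 2)) ^ q ≤ 1 / 0.9 := by
      have : R / (c / 2) = 0.1 / p := by rw [hc]; field_simp; norm_num
      calc (1 + R / (c / 2)) ^ q ≤ Real.exp (0.1 / p) ^ q := by
            rw [this]
            gcongr
            linarith [Real.add_one_le_exp (0.1 / p : ℝ)]
        _ = Real.exp (q * (0.1 / p)) := (Real.exp_nat_mul _ _).symm
        _ ≤ Real.exp 0.1 := by
            gcongr
            rw [mul_div_left_comm]
            have : (q : ℝ) / p ≤ 1 := by
              rw [div_le_one hp0, hpq']; linarith
            linarith
        _ ≤ 1 / 0.9 := by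
            have := Real.add_one_le_exp (-0.1 : ℝ)
            rw [Real.exp_neg] at this
            rw [le_div_iff₀ (by norm_num)]
            have h2 : Real.exp 0.1 * (Real.exp 0.1)⁻¹ = 1 := mul_inv_cancel₀ (Real.exp_pos _).ne'
            nlinarith [Real.exp_pos (0.1 : ℝ)]
    have hK0 : 0 < (1 + R / (c / 2)) ^ q := by positivity
    have e2 : Real.exp (-((q + 1) * (1 / m) / (c * (1 + R / (c / 2)) ^ q))) ^ m ≤
        Real.exp (-(0.9 / (20 * R))) := by
      rw [← Real.exp_nat_mul, Real.exp_le_exp, ← hpq']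
      have : m * -(p * (1 / m) / (c * (1 + R / (c / 2)) ^ q)) =
          -((1 / (1 + R / (c / 2)) ^ q) / (20 * R)) := by
        rw [hc]; field_simp
      rw [this]
      gcongr
      rw [le_div_iff₀ hK0]
      linarith
    have e3 : c ^ p ≤ (c - 1 / 2) ^ p * Real.exp (0.6 / (20 * R)) := by
      have h1 : c ≤ (c - 1 / 2) * Real.exp (1 / (2 * c - 1)) := by
        have := Real.add_one_le_exp (1 / (2 * c - 1))
        calc c = (c - 1 / 2) * (1 / (2 * c - 1) + 1) := by
              have : 2 * c - 1 ≠ 0 := by linarith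
              linear_combination (-1 / 2 : ℝ) * mul_one_div_cancel this
          _ ≤ _ := mul_le_mul_of_nonneg_left this (by linarith)
      calc c ^ p ≤ ((c - 1 / 2) * Real.exp (1 / (2 * c - 1))) ^ p := by gcongr
        _ = (c - 1 / 2) ^ p * Real.exp (p * (1 / (2 * c - 1))) := by
            rw [mul_pow, ← Real.exp_nat_mul]
        _ ≤ _ := by
            refine mul_le_mul_of_nonneg_left (Real.exp_le_exp.2 ?_) (pow_nonneg (by linarith) p)
            rw [mul_one_div, div_le_div_iff₀ (by linarith) (by positivity)]
            linarith
    calc _ ≤ (c - 1 / 2) ^ p * Real.exp (0.6 / (20 * R)) * Fintype.card ι *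
          Real.exp (-(0.9 / (20 * R))) := by
          have : 0 < c - 1 / 2 := by linarith
          gcongr
      _ = (c - 1 / 2) ^ p * (Fintype.card ι *
          (Real.exp (0.6 / (20 * R)) * Real.exp (-(0.9 / (20 * R))))) := by ring
      _ = _ := by
        rw [← Real.exp_add,
          show 0.6 / (20 * R) + -(0.9 / (20 * R)) = -(3 / (200 * R)) by field_simp; norm_num]

end RandomGramTails

section ContinuousL2

open Matrix

variable {X : Type*} [TopologicalSpace X] [MeasurableSpace X] {μ : Measure X}

/-- Continuous functions agreeing almost everywhere agree on the support of the measure. -/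
theorem ContinuousMap.eq_of_mem_support {f g : C(X, ℝ)} (h : f =ᵐ[μ] g) {x : X}
    (hx : x ∈ μ.support) : f x = g x := by
  by_contra hne
  have hU : {x | f x ≠ g x} ∈ nhds x := (isOpen_ne_fun f.continuous g.continuous).mem_nhds hne
  exact ((Measure.mem_support_iff_forall x).1 hx _ hU).ne' h

variable [CompactSpace X] [BorelSpace X] [IsProbabilityMeasure μ]

theorem eLpNorm_sub_eq_ofReal_norm (f g : C(X, ℝ)) :
    eLpNorm (⇑f - ⇑g) 2 μ = ENNReal.ofReal ‖ContinuousMap.toLp 2 μ ℝ (f - g)‖ := by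
  rw [← ContinuousMap.coe_sub, Lp.norm_def, ENNReal.ofReal_toReal (Lp.eLpNorm_ne_top _)]
  exact eLpNorm_congr_ae (ContinuousMap.coeFn_toLp (p := 2) (𝕜 := ℝ) μ (f - g)).symm

theorem norm_toLp_le_norm (f : C(X, ℝ)) : ‖ContinuousMap.toLp 2 μ ℝ f‖ ≤ ‖f‖ := by
  have h := eLpNorm_sub_eq_ofReal_norm (μ := μ) f 0
  rw [sub_zero] at h
  rw [← ENNReal.ofReal_le_ofReal_iff (norm_nonneg f), ← h]
  refine (eLpNorm_le_of_ae_bound (C := ‖f‖) (.of_forall fun x => ?_)).trans ?_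
  · simpa using f.norm_coe_le_norm x
  · simp

theorem inner_toLp_eq_integral (f g : C(X, ℝ)) :
    inner ℝ (ContinuousMap.toLp 2 μ ℝ f) (ContinuousMap.toLp 2 μ ℝ g) = ∫ x, f x * g x ∂μ := by
  rw [ContinuousMap.inner_toLp]
  simp [mul_comm]

variable (μ) in
/-- A finite orthonormal system in `L²(μ)` of continuous functions in terms of which every function
of `W` can be expanded on the support of `μ`. -/
structure IsOrthonormalFrame (W : Submodule ℝ C(X, ℝ)) {M : ℕ} (e : Fin M → C(X, ℝ)) : Prop where
  orthonormal : ∀ i j, ∫ x, e i x * e j x ∂μ = if i = j then 1 else 0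
  expand : ∀ g ∈ W, ∃ v : Fin M → ℝ, (∀ x ∈ μ.support, g x = (fun i => e i x) ⬝ᵥ v) ∧
    v ⬝ᵥ v = ‖ContinuousMap.toLp 2 μ ℝ g‖ ^ 2

variable (μ) in
theorem exists_isOrthonormalFrame (W : Submodule ℝ C(X, ℝ)) [FiniteDimensional ℝ W] :
    ∃ M ≤ Module.finrank ℝ W, ∃ e : Fin M → C(X, ℝ), IsOrthonormalFrame μ W e := by
  set T : C(X, ℝ) →ₗ[ℝ] Lp ℝ 2 μ := (ContinuousMap.toLp 2 μ ℝ).toLinearMap with hT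
  set U := W.map T with hU
  let b := stdOrthonormalBasis ℝ U
  have lift : ∀ i, ∃ g : C(X, ℝ), T g = b i := fun i => by
    obtain ⟨g, -, hg⟩ := (b i).2
    exact ⟨g, hg⟩
  choose e he using lift
  refine ⟨_, Submodule.finrank_map_le T W, e, fun i j => ?_, fun g hg => ?_⟩
  · rw [← inner_toLp_eq_integral]
    change inner ℝ (T (e i)) (T (e j)) = _
    rw [he, he, ← Submodule.coe_inner]
    exact orthonormal_iff_ite.1 b.orthonormal i j
  · set u : U := ⟨T g, Submodule.mem_map_of_mem hg⟩ with hu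
    refine ⟨fun i => inner ℝ (b i) u, fun x hx => ?_, ?_⟩
    · have h1 : T (∑ i, inner ℝ (b i) u • e i) = T g := by
        have := congrArg (Subtype.val) (b.sum_repr' u)
        rw [map_sum]
        simpa [he] using this
      have h2 : (⇑(∑ i, inner ℝ (b i) u • e i) : X → ℝ) =ᵐ[μ] g := by
        have a1 := ContinuousMap.coeFn_toLp (p := 2) (𝕜 := ℝ) μ (∑ i, inner ℝ (b i) u • e i)
        have a2 := ContinuousMap.coeFn_toLp (p := 2) (𝕜 := ℝ) μ g
        refine a1.symm.trans (Filter.EventuallyEq.trans ?_ a2)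
        exact Filter.EventuallyEq.of_eq (congrArg (fun l : Lp ℝ 2 μ => (l : X → ℝ)) h1)
      rw [← ContinuousMap.eq_of_mem_support h2 hx]
      simp only [ContinuousMap.coe_sum, ContinuousMap.coe_smul, Finset.sum_apply, Pi.smul_apply,
        smul_eq_mul, dotProduct]
      exact Finset.sum_congr rfl fun i _ => mul_comm _ _
    · have := b.sum_sq_inner_right u
      simp only [dotProduct, ← sq]
      exact this

theorem IsOrthonormalFrame.abs_apply_le {W : Submodule ℝ C(X, ℝ)} {M : ℕ} {e : Fin M → C(X, ℝ)}
    (h : IsOrthonormalFrame μ W e) {g : C(X, ℝ)} (hg : g ∈ W) {x : X} (hx : x ∈ μ.support) :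
    |g x| ≤ √(∑ i, e i x ^ 2) * ‖ContinuousMap.toLp 2 μ ℝ g‖ := by
  obtain ⟨v, hv, hv'⟩ := h.expand g hg
  rw [hv x hx]
  refine abs_le_of_sq_le_sq ?_ (by positivity)
  rw [mul_pow, Real.sq_sqrt (by positivity), ← hv']
  simpa [dotProduct, ← sq] using
    Finset.sum_mul_sq_le_sq_mul_sq Finset.univ (fun i => e i x) v

theorem integrable_mul_continuousMap (f g : C(X, ℝ)) : Integrable (fun x => f x * g x) μ :=
  (f * g).continuous.integrable_of_hasCompactSupport (HasCompactSupport.of_compactSpace _)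

theorem IsOrthonormalFrame.integral_sum_sq {W : Submodule ℝ C(X, ℝ)} {M : ℕ}
    {e : Fin M → C(X, ℝ)} (h : IsOrthonormalFrame μ W e) :
    ∫ x, ∑ i, e i x ^ 2 ∂μ = M := by
  simp only [sq]
  rw [integral_finsetSum _ fun i _ => integrable_mul_continuousMap _ _]
  simp [h.orthonormal]

/-- A probability density dominating the reciprocal Christoffel functions of a sequence of spaces,
up to dimension and polynomial factors. -/
theorem exists_density {W : ℕ → Submodule ℝ C(X, ℝ)} {M : ℕ → ℕ} {e : ∀ j, Fin (M j) → C(X, ℝ)}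
    (h : ∀ j, IsOrthonormalFrame μ (W j) (e j)) {B : ℕ → ℝ} (hB : ∀ j, 0 < B j)
    (hMB : ∀ j, (M j : ℝ) ≤ B j) :
    ∃ ρ : X → ℝ, Measurable ρ ∧ (∀ x, 0 < ρ x) ∧ ∫ x, ρ x ∂μ = 1 ∧
      ∃ G : Set X, MeasurableSet G ∧ G ∈ ae μ ∧
        ∀ x ∈ G, ∀ j, ∑ i, e j i x ^ 2 ≤ 2 * B j * (j + 2) ^ 2 * ρ x := by
  set w : ℕ → X → ℝ := fun j x => (∑ i, e j i x ^ 2) / (B j * ((j + 1) * (j + 2))) with hw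
  have hD : ∀ j : ℕ, 0 < B j * ((j + 1) * (j + 2)) := fun j => by
    have := hB j
    positivity
  have hw0 : ∀ j x, 0 ≤ w j x := fun j x => div_nonneg (by positivity) (hD j).le
  have hwc : ∀ j, Continuous (w j) := fun j => by fun_prop
  set φ : X → ENNReal := fun x => ∑' j, ENNReal.ofReal (w j x) with hφ
  have hwm : ∀ j, Measurable fun x => ENNReal.ofReal (w j x) := fun j =>
    ENNReal.measurable_ofReal.comp (hwc j).measurable
  have hφm : Measurable φ := Measurable.tsum hwm
  have tele : ∀ k : ℕ, ∑ j ∈ Finset.range k, 1 / (((j : ℝ) + 1) * (j + 2)) = 1 - 1 / (k + 1) := by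
    intro k
    induction k with
    | zero => simp
    | succ k ih =>
      rw [Finset.sum_range_succ, ih]
      push_cast
      field_simp
      ring
  have hφ1 : ∫⁻ x, φ x ∂μ ≤ 1 := by
    rw [hφ, lintegral_tsum fun j => (hwm j).aemeasurable]
    refine ENNReal.tsum_le_of_sum_range_le fun k => ?_
    have each : ∀ j, ∫⁻ x, ENNReal.ofReal (w j x) ∂μ ≤
        ENNReal.ofReal (1 / (((j : ℝ) + 1) * (j + 2))) := fun j => by
      rw [← ofReal_integral_eq_lintegral_ofReal
        ((hwc j).integrable_of_hasCompactSupport (HasCompactSupport.of_compactSpace _))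
        (.of_forall (hw0 j)), integral_div, (h j).integral_sum_sq]
      refine ENNReal.ofReal_le_ofReal ?_
      rw [div_le_div_iff₀ (hD j) (by positivity), one_mul]
      exact mul_le_mul_of_nonneg_right (hMB j) (by positivity)
    refine (Finset.sum_le_sum fun j _ => each j).trans ?_
    rw [← ENNReal.ofReal_sum_of_nonneg fun j _ => by positivity, tele, ENNReal.ofReal_le_one]
    have : (0 : ℝ) ≤ 1 / (k + 1) := by positivity
    linarith
  have hwφ : ∀ j x, ENNReal.ofReal (w j x) ≤ φ x := fun j x =>
    ENNReal.le_tsum (f := fun j => ENNReal.ofReal (w j x)) j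
  clear_value φ
  have hfin : ∀ᵐ x ∂μ, φ x < ⊤ :=
    ae_lt_top hφm (hφ1.trans_lt ENNReal.one_lt_top).ne
  have hφi : Integrable (fun x => (φ x).toReal) μ :=
    integrable_toReal_of_lintegral_ne_top hφm.aemeasurable (hφ1.trans_lt ENNReal.one_lt_top).ne
  set Z := 1 + ∫ x, (φ x).toReal ∂μ with hZ
  have hZ1 : 1 ≤ Z := by
    have : 0 ≤ ∫ x, (φ x).toReal ∂μ := integral_nonneg fun x => ENNReal.toReal_nonneg
    linarith
  have hZ2 : Z ≤ 2 := by
    rw [hZ, integral_toReal hφm.aemeasurable hfin]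
    have := ENNReal.toReal_mono ENNReal.one_ne_top hφ1
    rw [ENNReal.toReal_one] at this
    linarith
  refine ⟨fun x => (1 + (φ x).toReal) / Z, (measurable_const.add hφm.ennreal_toReal).div_const Z,
    fun x => ?_, ?_, {x | φ x < ⊤},
    hφm measurableSet_Iio, hfin, fun x hx j => ?_⟩
  · have := ENNReal.toReal_nonneg (a := φ x)
    positivity
  · rw [integral_div, integral_add (integrable_const _) hφi]
    simp only [integral_const, probReal_univ, one_smul]
    exact div_self (by linarith)
  · have h1 : w j x ≤ (φ x).toReal := by
      rw [← ENNReal.ofReal_le_iff_le_toReal (ne_of_lt hx)]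
      exact hwφ j x
    simp only [hw, div_le_iff₀ (hD j)] at h1
    have h0 := ENNReal.toReal_nonneg (a := φ x)
    have h2 : (φ x).toReal ≤ 2 * ((1 + (φ x).toReal) / Z) := by
      rw [mul_div_assoc', le_div_iff₀ (by linarith)]
      nlinarith
    calc ∑ i, e j i x ^ 2 ≤ (φ x).toReal * (B j * ((j + 1) * (j + 2))) := h1
      _ ≤ 2 * ((1 + (φ x).toReal) / Z) * (B j * ((j + 2) * (j + 2))) := by
        have := hB j
        gcongr
        norm_num
      _ = _ := by ring

end ContinuousL2

section WeightedSampling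

open Matrix

variable {X : Type*} [MeasurableSpace X] {μ : Measure X}

theorem isProbabilityMeasure_withDensity_ofReal {ρ : X → ℝ} (hρ0 : ∀ x, 0 < ρ x)
    (hρ1 : ∫ x, ρ x ∂μ = 1) :
    IsProbabilityMeasure (μ.withDensity fun x => ENNReal.ofReal (ρ x)) := by
  have hi : Integrable ρ μ := by
    by_contra h
    rw [integral_undef h] at hρ1
    exact zero_ne_one hρ1
  refine ⟨?_⟩
  rw [withDensity_apply _ MeasurableSet.univ, Measure.restrict_univ,
    ← ofReal_integral_eq_lintegral_ofReal hi (.of_forall fun x => (hρ0 x).le), hρ1,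
    ENNReal.ofReal_one]

variable [TopologicalSpace X] [BorelSpace X]

/-- Normalized evaluation vectors of an orthonormal system at a point sampled from the density
`ρ`. -/
theorem exists_sampling_vectors {ρ : X → ℝ} (hρm : Measurable ρ) (hρ0 : ∀ x, 0 < ρ x)
    {M : ℕ} {e : Fin M → C(X, ℝ)} (he : ∀ i j, ∫ x, e i x * e j x ∂μ = if i = j then 1 else 0)
    {G : Set X} (hGm : MeasurableSet G) (hG : G ∈ ae μ) {m : ℕ} (hm : 0 < m) {R : ℝ}
    (hR : 0 ≤ R) (hK : ∀ x ∈ G, ∑ i, e i x ^ 2 ≤ m * R * ρ x) :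
    ∃ y : X → Fin M → ℝ, Measurable y ∧ (∀ x, y x ⬝ᵥ y x ≤ R) ∧
      (∀ i j, ∫ x, y x i * y x j ∂(μ.withDensity fun x => ENNReal.ofReal (ρ x)) =
        if i = j then (1 / m : ℝ) else 0) ∧
      ∀ x ∈ G, ∀ v, (y x ⬝ᵥ v) ^ 2 = 1 / m * ((ρ x)⁻¹ * ((fun i => e i x) ⬝ᵥ v) ^ 2) := by
  have hm0 : (0 : ℝ) < m := by exact_mod_cast hm
  have hs : ∀ x, 0 < m * ρ x := fun x => mul_pos hm0 (hρ0 x)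
  set z : X → Fin M → ℝ := fun x => (√(m * ρ x))⁻¹ • fun i => e i x with hz
  have hzm : Measurable z := by
    refine measurable_pi_lambda _ fun i => ?_
    exact ((hρm.const_mul _).sqrt.inv).mul (e i).continuous.measurable
  have hzz : ∀ x i j, z x i * z x j = (m * ρ x)⁻¹ * (e i x * e j x) := fun x i j => by
    have h1 : (√(m * ρ x))⁻¹ * (√(m * ρ x))⁻¹ = (m * ρ x)⁻¹ := by
      rw [← mul_inv, Real.mul_self_sqrt (hs x).le]
    rw [← h1]
    simp only [hz, Pi.smul_apply, smul_eq_mul]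
    ring
  refine ⟨G.indicator z, hzm.indicator hGm, fun x => ?_, fun i j => ?_, fun x hx v => ?_⟩
  · by_cases hx : x ∈ G
    · rw [Set.indicator_of_mem hx]
      have h1 : z x ⬝ᵥ z x = (m * ρ x)⁻¹ * ∑ i, e i x ^ 2 := by
        simp only [dotProduct, hzz, Finset.mul_sum, sq]
      rw [h1, inv_mul_le_iff₀ (hs x)]
      linarith [hK x hx]
    · simpa [Set.indicator_of_notMem hx] using hR
  · rw [integral_withDensity_eq_integral_toReal_smul₀ (by fun_prop) (by simp)]
    have h1 : (fun x => (ENNReal.ofReal (ρ x)).toReal • (G.indicator z x i * G.indicator z x j))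
        =ᵐ[μ] fun x => (1 / m : ℝ) * (e i x * e j x) := by
      filter_upwards [hG] with x hx
      rw [Set.indicator_of_mem hx, hzz, ENNReal.toReal_ofReal (hρ0 x).le, smul_eq_mul]
      have := (hρ0 x).ne'
      field_simp
    rw [integral_congr_ae h1, integral_const_mul, he]
    split_ifs <;> simp
  · rw [Set.indicator_of_mem hx, hz]
    simp only [smul_dotProduct, smul_eq_mul]
    rw [mul_pow, inv_pow, Real.sq_sqrt (hs x).le]
    field_simp

variable [CompactSpace X] [IsProbabilityMeasure μ]
  {ρ : X → ℝ} {M : ℕ} {e : Fin M → C(X, ℝ)} {W : Submodule ℝ C(X, ℝ)}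

/-- With high probability the discrete norm is controlled by the `L²` norm. -/
theorem measure_exists_discrete_gt_le (hρm : Measurable ρ) (hρ0 : ∀ x, 0 < ρ x)
    (hρ1 : ∫ x, ρ x ∂μ = 1) (he : IsOrthonormalFrame μ W e)
    {G : Set X} (hGm : MeasurableSet G) (hG : G ∈ ae μ) {m : ℕ} (hm : 0 < m) {R : ℝ}
    (hR : 0 < R) (hK : ∀ x ∈ G, ∑ i, e i x ^ 2 ≤ m * R * ρ x) {p : ℕ} (hp : 8 ≤ p * R) :
    (Measure.pi fun _ : Fin m => μ.withDensity fun x => ENNReal.ofReal (ρ x))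
        {χ | (∀ k, χ k ∈ G ∩ μ.support) ∧ ∃ g ∈ W,
          p * R * ‖ContinuousMap.toLp 2 μ ℝ g‖ ^ 2 < 1 / m * ∑ k, (ρ (χ k))⁻¹ * g (χ k) ^ 2} ≤
      ENNReal.ofReal (M * Real.exp (-(p / 3))) := by
  have := isProbabilityMeasure_withDensity_ofReal hρ0 hρ1
  obtain ⟨y, hy, hyR, hcov, hyv⟩ :=
    exists_sampling_vectors hρm hρ0 he.orthonormal hGm hG hm hR.le hK
  have key := measure_exists_quadratic_gt_le hy hyR hm hcov hR hp
  rw [Fintype.card_fin] at key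
  refine (measure_mono ?_).trans key
  rintro χ ⟨hχ, g, hg, hlt⟩
  obtain ⟨v, hv, hvv⟩ := he.expand g hg
  refine ⟨v, ?_⟩
  rw [← hvv, Finset.mul_sum] at hlt
  simpa only [hyv _ (hχ _).1, ← hv _ (hχ _).2] using hlt

/-- With high probability the discrete norm controls the `L²` norm. -/
theorem measure_exists_discrete_lt_le (hρm : Measurable ρ) (hρ0 : ∀ x, 0 < ρ x)
    (hρ1 : ∫ x, ρ x ∂μ = 1) (he : IsOrthonormalFrame μ W e)
    {G : Set X} (hGm : MeasurableSet G) (hG : G ∈ ae μ) {m : ℕ} (hm : 0 < m) {R : ℝ}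
    (hR : 0 < R) (hK : ∀ x ∈ G, ∑ i, e i x ^ 2 ≤ m * R * ρ x) :
    (Measure.pi fun _ : Fin m => μ.withDensity fun x => ENNReal.ofReal (ρ x))
        {χ | (∀ k, χ k ∈ G ∩ μ.support) ∧ ∃ g ∈ W,
          1 / m * ∑ k, (ρ (χ k))⁻¹ * g (χ k) ^ 2 < 1 / 2 * ‖ContinuousMap.toLp 2 μ ℝ g‖ ^ 2} ≤
      ENNReal.ofReal (M * Real.exp (-(3 / (200 * R)))) := by
  have := isProbabilityMeasure_withDensity_ofReal hρ0 hρ1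
  obtain ⟨y, hy, hyR, hcov, hyv⟩ :=
    exists_sampling_vectors hρm hρ0 he.orthonormal hGm hG hm hR.le hK
  have key := measure_exists_quadratic_lt_le hy hyR hm hcov hR
  rw [Fintype.card_fin] at key
  refine (measure_mono ?_).trans key
  rintro χ ⟨hχ, g, hg, hlt⟩
  obtain ⟨v, hv, hvv⟩ := he.expand g hg
  refine ⟨v, ?_⟩
  rw [← hvv, Finset.mul_sum] at hlt
  simpa only [hyv _ (hχ _).1, ← hv _ (hχ _).2] using hlt

end WeightedSampling

section PointwiseApproximation

open Filter Topology

variable {X : Type*} [TopologicalSpace X] [MeasurableSpace X] {μ : Measure X}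
  [CompactSpace X] [BorelSpace X] [IsProbabilityMeasure μ]
  {U : ℕ → Submodule ℝ C(X, ℝ)} {M : ℕ → ℕ} {e : ∀ k, Fin (M k) → C(X, ℝ)}

theorem norm_toLp_sub_le (f g h : C(X, ℝ)) : ‖ContinuousMap.toLp 2 μ ℝ (f - g)‖ ≤
    ‖ContinuousMap.toLp 2 μ ℝ (h - f)‖ + ‖ContinuousMap.toLp 2 μ ℝ (h - g)‖ := by
  have : f - g = -(h - f) + (h - g) := by abel
  rw [this, map_add, map_neg]
  exact (norm_add_le _ _).trans (by rw [norm_neg])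

/-- Differences of consecutive approximants are summable at the points where the Christoffel
functions are controlled. -/
theorem abs_sub_succ_apply_le (h : ∀ k, IsOrthonormalFrame μ (U k ⊔ U (k + 1)) (e k))
    {f : C(X, ℝ)} {a : ℕ → C(X, ℝ)} (ha : ∀ k, a k ∈ U k) {ε : ℕ → ℝ}
    (hε : ∀ k, ‖ContinuousMap.toLp 2 μ ℝ (f - a k)‖ ≤ ε k)
    (hε' : ∀ k, ‖ContinuousMap.toLp 2 μ ℝ (f - a (k + 1))‖ ≤ ε k) {x : X}
    (hx : x ∈ μ.support) (k : ℕ) :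
    dist (a k x) (a (k + 1) x) ≤ 2 * (√(∑ i, e k i x ^ 2) * ε k) := by
  have hmem : a k - a (k + 1) ∈ U k ⊔ U (k + 1) :=
    sub_mem (Submodule.mem_sup_left (ha k)) (Submodule.mem_sup_right (ha (k + 1)))
  have h1 := (h k).abs_apply_le hmem hx
  have h2 := norm_toLp_sub_le (μ := μ) (a k) (a (k + 1)) f
  rw [Real.dist_eq]
  calc |a k x - a (k + 1) x| ≤ √(∑ i, e k i x ^ 2) * ‖ContinuousMap.toLp 2 μ ℝ (a k - a (k + 1))‖ :=
        h1
    _ ≤ √(∑ i, e k i x ^ 2) * (ε k + ε k) := by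
        gcongr
        exact h2.trans (add_le_add (hε k) (hε' k))
    _ = _ := by ring

/-- `L²` approximants of a single function converge pointwise almost everywhere. -/
theorem ae_tendsto_apply (h : ∀ k, IsOrthonormalFrame μ (U k ⊔ U (k + 1)) (e k))
    {f : C(X, ℝ)} {a : ℕ → C(X, ℝ)} (ha : ∀ k, a k ∈ U k) {ε : ℕ → ℝ}
    (hε : ∀ k, ‖ContinuousMap.toLp 2 μ ℝ (f - a k)‖ ≤ ε k)
    (hε' : ∀ k, ‖ContinuousMap.toLp 2 μ ℝ (f - a (k + 1))‖ ≤ ε k)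
    (hε0 : Tendsto ε atTop (𝓝 0))
    (hsupp : μ.support ∈ ae μ)
    (hs : ∀ᵐ x ∂μ, Summable fun k => √(∑ i, e k i x ^ 2) * ε k) :
    ∀ᵐ x ∂μ, Tendsto (fun k => a k x) atTop (𝓝 (f x)) := by
  have hL : Tendsto (fun k => eLpNorm (⇑(a k) - ⇑f) 2 μ) atTop (𝓝 0) := by
    refine tendsto_of_tendsto_of_tendsto_of_le_of_le tendsto_const_nhds
      (ENNReal.ofReal_zero ▸ ENNReal.tendsto_ofReal hε0) (fun k => zero_le) fun k => ?_
    rw [eLpNorm_sub_eq_ofReal_norm, ← neg_sub, map_neg, norm_neg]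
    exact ENNReal.ofReal_le_ofReal (hε k)
  have hM := tendstoInMeasure_of_tendsto_eLpNorm two_ne_zero
    (fun k => (a k).continuous.aestronglyMeasurable) f.continuous.aestronglyMeasurable hL
  obtain ⟨ns, hns, hsub⟩ := hM.exists_seq_tendsto_ae
  filter_upwards [hsub, hsupp, hs] with x hx1 hx2 hx3
  have hc : CauchySeq fun k => a k x :=
    cauchySeq_of_dist_le_of_summable _ (abs_sub_succ_apply_le h ha hε hε' hx2) (hx3.mul_left 2)
  obtain ⟨l, hl⟩ := cauchySeq_tendsto_of_complete hc
  rwa [tendsto_nhds_unique hx1 (hl.comp hns.tendsto_atTop)]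

variable [SecondCountableTopology X] [LocallyCompactSpace X]

/-- Almost everywhere, the `L²` approximants of all functions of a class converge pointwise
simultaneously. -/
theorem ae_forall_tendsto_apply (h : ∀ k, IsOrthonormalFrame μ (U k ⊔ U (k + 1)) (e k))
    {F : Set C(X, ℝ)} {a : C(X, ℝ) → ℕ → C(X, ℝ)} (ha : ∀ f ∈ F, ∀ k, a f k ∈ U k) {ε : ℕ → ℝ}
    (hε : ∀ f ∈ F, ∀ k, ‖ContinuousMap.toLp 2 μ ℝ (f - a f k)‖ ≤ ε k)
    (hε' : ∀ f ∈ F, ∀ k, ‖ContinuousMap.toLp 2 μ ℝ (f - a f (k + 1))‖ ≤ ε k)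
    (hε0 : Tendsto ε atTop (𝓝 0))
    (hs : ∀ᵐ x ∂μ, Summable fun k => √(∑ i, e k i x ^ 2) * ε k) :
    ∀ᵐ x ∂μ, ∀ f ∈ F, Tendsto (fun k => a f k x) atTop (𝓝 (f x)) := by
  have hsupp : μ.support ∈ ae μ := Measure.support_mem_ae
  obtain ⟨F₀, hF₀, hc, hd⟩ :=
    (TopologicalSpace.IsSeparable.of_separableSpace F).exists_countable_dense_subset
  have hae : ∀ᵐ x ∂μ, ∀ f ∈ F₀, Tendsto (fun k => a f k x) atTop (𝓝 (f x)) :=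
    (ae_ball_iff hc).2 fun f hf => ae_tendsto_apply h (ha f (hF₀ hf)) (hε f (hF₀ hf))
      (hε' f (hF₀ hf)) hε0 hsupp hs
  filter_upwards [hae, hsupp, hs] with x hx1 hx2 hx3 f hf
  set s : ℕ → ℝ := fun k => √(∑ i, e k i x ^ 2) with hsdef
  have hs0 : ∀ k, 0 ≤ s k := fun k => Real.sqrt_nonneg _
  have bound : ∀ k, dist (a f k x) (f x) ≤ ∑' j, 2 * (s (k + j) * ε (k + j)) + 2 * (s k * ε k) := by
    intro k
    refine le_of_forall_pos_le_add fun η hη => ?_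
    obtain ⟨f', hf', hff'⟩ := Metric.mem_closure_iff.1 (hd hf) (η / (1 + s k))
      (div_pos hη (by linarith [hs0 k]))
    have hf'F := hF₀ hf'
    rw [lt_div_iff₀ (by linarith [hs0 k])] at hff'
    have t1 : dist (a f' k x) (f' x) ≤ ∑' j, 2 * (s (k + j) * ε (k + j)) :=
      dist_le_tsum_of_dist_le_of_tendsto _
        (abs_sub_succ_apply_le h (ha f' hf'F) (hε f' hf'F) (hε' f' hf'F) hx2) (hx3.mul_left 2)
        (hx1 f' hf') k
    have t2 : dist (f x) (f' x) ≤ dist f f' := ContinuousMap.dist_apply_le_dist x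
    have t3 : dist (a f k x) (a f' k x) ≤ s k * (ε k + dist f f' + ε k) := by
      have hmem : a f k - a f' k ∈ U k ⊔ U (k + 1) :=
        Submodule.mem_sup_left (sub_mem (ha f hf k) (ha f' hf'F k))
      refine ((h k).abs_apply_le hmem hx2).trans (mul_le_mul_of_nonneg_left ?_ (hs0 k))
      have n1 := norm_toLp_sub_le (μ := μ) (a f k) (a f' k) f
      have n2 : ‖ContinuousMap.toLp 2 μ ℝ (f - a f' k)‖ ≤
          ‖ContinuousMap.toLp 2 μ ℝ (f - f')‖ + ‖ContinuousMap.toLp 2 μ ℝ (f' - a f' k)‖ := by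
        rw [← sub_add_sub_cancel f f' (a f' k), map_add]
        exact norm_add_le _ _
      have n3 := norm_toLp_le_norm (μ := μ) (f - f')
      rw [← dist_eq_norm] at n3
      linarith [hε f hf k, hε f' hf'F k]
    have t4 : dist (a f k x) (f x) ≤
        dist (a f k x) (a f' k x) + dist (a f' k x) (f' x) + dist (f x) (f' x) := by
      rw [dist_comm (f x)]
      exact dist_triangle4 _ _ _ _
    nlinarith
  rw [tendsto_iff_dist_tendsto_zero]
  have hx3' : Summable fun k => 2 * (s k * ε k) := hx3.mul_left 2
  refine squeeze_zero (fun k => dist_nonneg) bound ?_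
  have l1 := tendsto_sum_nat_add fun k => 2 * (s k * ε k)
  simp only [add_comm _ _] at l1
  simpa [add_comm] using l1.add hx3'.tendsto_atTop_zero

end PointwiseApproximation

section DiscreteNorm

open Filter Topology

variable {m : ℕ} {w : Fin m → ℝ}

/-- The weighted Euclidean norm `(∑ k, w k * h k ^ 2) ^ (1 / 2)`. -/
def discreteNorm (w h : Fin m → ℝ) : ℝ := √(∑ k, w k * h k ^ 2)

theorem discreteNorm_eq_norm (hw : ∀ k, 0 ≤ w k) (h : Fin m → ℝ) :
    discreteNorm w h = ‖WithLp.toLp 2 fun k => √(w k) * h k‖ := by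
  rw [discreteNorm, EuclideanSpace.norm_eq]
  simp [mul_pow, Real.sq_sqrt (hw _)]

theorem discreteNorm_sub_eq_dist (hw : ∀ k, 0 ≤ w k) (h h' : Fin m → ℝ) :
    discreteNorm w (fun k => h k - h' k) =
      dist (WithLp.toLp 2 fun k => √(w k) * h k) (WithLp.toLp 2 fun k => √(w k) * h' k) := by
  rw [discreteNorm_eq_norm hw, dist_eq_norm, ← WithLp.toLp_sub]
  congr 2
  ext k
  simp [mul_sub]

theorem discreteNorm_sub_le_tsum (hw : ∀ k, 0 ≤ w k) {a : ℕ → Fin m → ℝ} {f : Fin m → ℝ}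
    {σ : ℕ → ℝ} (hσ : Summable σ)
    (ha : ∀ j, discreteNorm w (fun k => a j k - a (j + 1) k) ≤ σ j)
    (hf : ∀ k, Tendsto (fun j => a j k) atTop (𝓝 (f k))) :
    discreteNorm w (fun k => a 0 k - f k) ≤ ∑' j, σ j := by
  simp only [discreteNorm_sub_eq_dist hw] at ha ⊢
  refine dist_le_tsum_of_dist_le_of_tendsto₀
    (f := fun j => WithLp.toLp 2 fun k => √(w k) * a j k) σ ha hσ ?_
  refine ((PiLp.continuous_toLp 2 _).tendsto _).comp (tendsto_pi_nhds.2 fun k => ?_)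
  exact (hf k).const_mul _

/-- Quasi-optimality of weighted least squares: if the discrete norm dominates the `L²` norm on the
space of ansatz functions and the discrete norms of a telescoping approximation are summable, then
least squares approximants are `L²` close. -/
theorem norm_toLp_sub_le_of_minimizer {X : Type*} [TopologicalSpace X] [MeasurableSpace X]
    {μ : Measure X} [CompactSpace X] [BorelSpace X] [IsProbabilityMeasure μ]
    (hw : ∀ k, 0 ≤ w k) {χ : Fin m → X} {f g : C(X, ℝ)} {a : ℕ → C(X, ℝ)} {σ : ℕ → ℝ}
    (hσ : Summable σ) (ha : ∀ j, ∑ k, w k * (a j - a (j + 1)) (χ k) ^ 2 ≤ σ j ^ 2)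
    (hσ0 : ∀ j, 0 ≤ σ j)
    (hf : ∀ k, Tendsto (fun j => a j (χ k)) atTop (𝓝 (f (χ k))))
    (hmin : ∑ k, w k * |f (χ k) - g (χ k)| ^ 2 ≤ ∑ k, w k * |f (χ k) - a 0 (χ k)| ^ 2)
    (hlow : 1 / 2 * ‖ContinuousMap.toLp 2 μ ℝ (a 0 - g)‖ ^ 2 ≤
      ∑ k, w k * (a 0 - g) (χ k) ^ 2) :
    ‖ContinuousMap.toLp 2 μ ℝ (f - g)‖ ≤
      ‖ContinuousMap.toLp 2 μ ℝ (f - a 0)‖ + 3 * ∑' j, σ j := by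
  set S := ∑' j, σ j with hS
  have hS0 : 0 ≤ S := tsum_nonneg hσ0
  have h1 : discreteNorm w (fun k => a 0 (χ k) - f (χ k)) ≤ S :=
    discreteNorm_sub_le_tsum (a := fun j k => a j (χ k)) hw hσ
      (fun j => Real.sqrt_le_iff.2 ⟨hσ0 j, ha j⟩) hf
  have h2 : discreteNorm w (fun k => f (χ k) - g (χ k)) ≤ S := by
    refine le_trans (Real.sqrt_le_sqrt ?_) h1
    simp only [sq_abs] at hmin
    refine hmin.trans_eq (Finset.sum_congr rfl fun k _ => ?_)
    rw [← neg_sub, neg_sq]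
  have h3 : discreteNorm w (fun k => a 0 (χ k) - g (χ k)) ≤ 2 * S := by
    rw [discreteNorm_sub_eq_dist hw] at h1 h2 ⊢
    exact (dist_triangle _ _ _).trans (by linarith)
  have h4 : ∑ k, w k * (a 0 - g) (χ k) ^ 2 ≤ (2 * S) ^ 2 :=
    (Real.sqrt_le_iff.1 h3).2
  have h5 : ‖ContinuousMap.toLp 2 μ ℝ (a 0 - g)‖ ≤ 3 * S :=
    abs_le_of_sq_le_sq' (by nlinarith) (by positivity) |>.2
  rw [← sub_add_sub_cancel f (a 0) g, map_add]
  exact (norm_add_le _ _).trans (by linarith)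

end DiscreteNorm

section Rates

open Filter Topology

theorem rpow_mul_log_rpow_le {α β : ℝ} (hα : 0 ≤ α) (hβ : 0 ≤ β) {n : ℕ} (hn : 2 ≤ n)
    {k i : ℕ} (hik : i ≤ k + 1) (hki : k ≤ i) :
    ((2 ^ i * n : ℕ) : ℝ) ^ (-α) * Real.log (2 ^ i * n : ℕ) ^ β ≤
      (2 ^ k : ℝ) ^ (-α) * (k + 2) ^ β * ((n : ℝ) ^ (-α) * Real.log n ^ β) := by
  have hn0 : (2 : ℝ) ≤ n := by exact_mod_cast hn
  have hL : Real.log 2 ≤ Real.log n := Real.log_le_log two_pos hn0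
  have hL0 : 0 ≤ Real.log 2 := Real.log_nonneg one_le_two
  have hik' : (i : ℝ) ≤ k + 1 := by exact_mod_cast hik
  have h2 : (2 : ℝ) ^ k ≤ 2 ^ i := pow_le_pow_right₀ one_le_two hki
  have hlog : Real.log (2 ^ i * n : ℕ) = i * Real.log 2 + Real.log n := by
    push_cast
    rw [Real.log_mul (by positivity) (by positivity), Real.log_pow]
  have h3 : Real.log (2 ^ i * n : ℕ) ≤ (k + 2) * Real.log n := by
    rw [hlog]
    nlinarith
  have h4 : 0 ≤ Real.log (2 ^ i * n : ℕ) := Real.log_natCast_nonneg _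
  have h5 : ((2 ^ i * n : ℕ) : ℝ) ^ (-α) ≤ (2 ^ k : ℝ) ^ (-α) * (n : ℝ) ^ (-α) := by
    rw [← Real.mul_rpow (by positivity) (by positivity)]
    refine Real.rpow_le_rpow_of_nonpos (by positivity) ?_ (by linarith)
    push_cast
    gcongr
  calc _ ≤ (2 ^ k : ℝ) ^ (-α) * (n : ℝ) ^ (-α) * ((k + 2) * Real.log n) ^ β := by
        gcongr
    _ = _ := by
        rw [Real.mul_rpow (by positivity) (by linarith)]
        ring

theorem summable_sqrt_two_pow_mul_rpow {α : ℝ} (hα : 1 / 2 < α) (β : ℝ) :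
    Summable fun k : ℕ => √(2 ^ k) * (k + 2) ^ 2 * ((2 ^ k : ℝ) ^ (-α) * (k + 2 : ℝ) ^ β) := by
  set r : ℝ := 2 ^ (1 / 2 - α) with hr
  have hr0 : 0 < r := Real.rpow_pos_of_pos two_pos _
  have hr1 : r < 1 := Real.rpow_lt_one_of_one_lt_of_neg one_lt_two (by linarith)
  obtain ⟨l, hl⟩ := exists_nat_ge β
  have hs0 : Summable fun k : ℕ => (k : ℝ) ^ (l + 2) * r ^ k :=
    summable_pow_mul_geometric_of_norm_lt_one (l + 2) (by rwa [Real.norm_of_nonneg hr0.le])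
  have hs : Summable fun k : ℕ => (r ^ 2)⁻¹ * (((k + 2 : ℕ) : ℝ) ^ (l + 2) * r ^ (k + 2)) :=
    ((summable_nat_add_iff (f := fun k : ℕ => (k : ℝ) ^ (l + 2) * r ^ k) 2).2 hs0).mul_left _
  refine Summable.of_nonneg_of_le (fun k => by positivity) (fun k => ?_) hs
  have h1 : √(2 ^ k) * (2 ^ k : ℝ) ^ (-α) = r ^ k := by
    rw [Real.sqrt_eq_rpow, ← Real.rpow_add (by positivity), hr, ← Real.rpow_natCast,
      ← Real.rpow_natCast, ← Real.rpow_mul zero_le_two, ← Real.rpow_mul zero_le_two]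
    ring_nf
  have h2 : (k + 2 : ℝ) ^ β ≤ (k + 2) ^ l := by
    rw [← Real.rpow_natCast]
    exact Real.rpow_le_rpow_of_exponent_le (by linarith [(Nat.cast_nonneg k : (0 : ℝ) ≤ k)]) hl
  calc √(2 ^ k) * (k + 2) ^ 2 * ((2 ^ k : ℝ) ^ (-α) * (k + 2 : ℝ) ^ β) =
        r ^ k * ((k + 2 : ℝ) ^ 2 * (k + 2 : ℝ) ^ β) := by rw [← h1]; ring
    _ ≤ r ^ k * ((k + 2 : ℝ) ^ 2 * (k + 2 : ℝ) ^ l) := by gcongr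
    _ = (r ^ 2)⁻¹ * (((k + 2 : ℕ) : ℝ) ^ (l + 2) * r ^ (k + 2)) := by
      clear_value r
      rw [pow_add r, pow_add _ l]
      push_cast
      field_simp

theorem two_pow_mul_exp_log_le {n : ℕ} (hn : 2 ≤ n) (j : ℕ) :
    3 * 2 ^ j * n * Real.exp (-(30 * (j + 1) * Real.log n)) ≤
      1 / (48000 * (n : ℝ) ^ 2) / 2 * (1 / 2) ^ (j + 1) := by
  have hn0 : (2 : ℝ) ≤ n := by exact_mod_cast hn
  have hn1 : (0 : ℝ) < n := by linarith
  have h1 : Real.exp (30 * (j + 1) * Real.log n) = (n : ℝ) ^ 3 * (n : ℝ) ^ 27 * ((n : ℝ) ^ 30) ^ j := by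
    rw [show 30 * ((j : ℝ) + 1) * Real.log n = ((30 * (j + 1) : ℕ) : ℝ) * Real.log n by
      push_cast; ring, Real.exp_nat_mul, Real.exp_log hn1]
    ring
  have h2 : (2 : ℝ) ^ 27 ≤ (n : ℝ) ^ 27 := by gcongr
  have h3 : (4 : ℝ) ^ j ≤ ((n : ℝ) ^ 30) ^ j := by
    refine pow_le_pow_left₀ (by norm_num) ?_ j
    calc (4 : ℝ) ≤ 2 ^ 30 := by norm_num
      _ ≤ _ := by gcongr
  have h4 : (4 : ℝ) ^ j = 2 ^ j * 2 ^ j := by rw [← mul_pow]; norm_num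
  rw [Real.exp_neg, h1, ← div_eq_mul_inv, one_div_pow, div_div, div_mul_div_comm,
    div_le_div_iff₀ (by positivity) (by positivity)]
  calc 3 * 2 ^ j * (n : ℝ) * (48000 * n ^ 2 * 2 * 2 ^ (j + 1)) =
        (n : ℝ) ^ 3 * (576000 * 4 ^ j) := by rw [h4]; ring
    _ ≤ (n : ℝ) ^ 3 * (2 ^ 27 * 4 ^ j) := by gcongr; norm_num
    _ ≤ (n : ℝ) ^ 3 * ((n : ℝ) ^ 27 * ((n : ℝ) ^ 30) ^ j) := by gcongr
    _ = _ := by ring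

/-- A union bound over a sequence of exceptional events of geometrically decaying probability. -/
theorem one_sub_le_measure_of_ae {Ω : Type*} [MeasurableSpace Ω] {P : Measure Ω}
    [IsProbabilityMeasure P] {S A : Set Ω} {B : ℕ → Set Ω} {δ : ℝ} (hδ : 0 ≤ δ)
    (h : ∀ᵐ ω ∂P, ω ∉ A → (∀ j, ω ∉ B j) → ω ∈ S) (hA : P A ≤ ENNReal.ofReal (δ / 2))
    (hB : ∀ j, P (B j) ≤ ENNReal.ofReal (δ / 2 * (1 / 2) ^ (j + 1))) :
    1 - ENNReal.ofReal δ ≤ P S := by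
  have hsum : P (⋃ j, B j) ≤ ENNReal.ofReal (δ / 2) := by
    refine (measure_iUnion_le B).trans (ENNReal.tsum_le_of_sum_range_le fun k => ?_)
    refine (Finset.sum_le_sum fun j _ => hB j).trans ?_
    rw [← ENNReal.ofReal_sum_of_nonneg fun j _ => by positivity, ← Finset.mul_sum]
    refine ENNReal.ofReal_le_ofReal (mul_le_of_le_one_right (by positivity) ?_)
    have := sum_geometric_two_le k
    simp only [pow_succ, ← Finset.sum_mul]
    linarith
  have hS : P (S ∪ (A ∪ ⋃ j, B j)) = 1 := by
    rw [← measure_univ (μ := P)]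
    refine measure_congr ?_
    filter_upwards [h] with ω hω
    refine propext ⟨fun _ => trivial, fun _ => ?_⟩
    change ω ∈ S ∪ (A ∪ ⋃ j, B j)
    by_cases hA : ω ∈ A
    · exact Or.inr (Or.inl hA)
    by_cases hB : ∃ j, ω ∈ B j
    · exact Or.inr (Or.inr (Set.mem_iUnion.2 hB))
    · exact Or.inl (hω hA (not_exists.1 hB))
  rw [tsub_le_iff_right, ← hS]
  refine (measure_union_le _ _).trans (add_le_add_right ((measure_union_le _ _).trans ?_) _)
  rw [← add_halves δ, ENNReal.ofReal_add (by positivity) (by positivity)]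
  exact add_le_add hA hsum

theorem ae_pi_forall {X : Type*} [MeasurableSpace X] {ν : Measure X} [IsProbabilityMeasure ν]
    {m : ℕ} {p : X → Prop} (h : ∀ᵐ x ∂ν, p x) :
    ∀ᵐ χ ∂(Measure.pi fun _ : Fin m => ν), ∀ k, p (χ k) :=
  ae_all_iff.2 fun k => (Measure.tendsto_eval_ae_ae (μ := fun _ : Fin m => ν) (i := k)).eventually h

end Rates

section RandomWeightedLeastSquares

open Filter Topology

variable {X : Type*} [TopologicalSpace X] [MeasurableSpace X] {μ : Measure X}
  [CompactSpace X] [BorelSpace X] [IsProbabilityMeasure μ]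

theorem exists_mem_norm_toLp_sub_le {V : Submodule ℝ C(X, ℝ)} {f : C(X, ℝ)} {r s : ℝ}
    (h : sInf {r : ℝ | ∃ g ∈ V, r = (eLpNorm (⇑f - ⇑g) 2 μ).toReal} ≤ r) (hrs : r < s) :
    ∃ g ∈ V, ‖ContinuousMap.toLp 2 μ ℝ (f - g)‖ ≤ s := by
  obtain ⟨_, ⟨g, hg, rfl⟩, hlt⟩ := exists_lt_of_csInf_lt
    (⟨_, 0, V.zero_mem, rfl⟩ : {r : ℝ | ∃ g ∈ V, r = (eLpNorm (⇑f - ⇑g) 2 μ).toReal}.Nonempty)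
    (h.trans_lt hrs)
  refine ⟨g, hg, ?_⟩
  rw [eLpNorm_sub_eq_ofReal_norm, ENNReal.toReal_ofReal (norm_nonneg _)] at hlt
  exact hlt.le

theorem sampling_parameters {n m : ℕ} {L : ℝ} (hn : 0 < n) (hL : 0 < L)
    (hm1 : 48000 * n * L ≤ m) (hm2 : m ≤ 2 * (48000 * n * L)) (hL1 : 1 ≤ 48000 * L) (j : ℕ) :
    let R : ℝ := 6 * 2 ^ j * n * (j + 2) ^ 2 / m
    let p : ℕ := ⌈(j + 1) * (48000 * L)⌉₊
    0 < R ∧ 8 ≤ p * R ∧ p * R ≤ (5 * √(2 ^ j) * (j + 2) ^ 2) ^ 2 ∧ 30 * (j + 1) * L ≤ p / 3 := by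
  intro R p
  have hn0 : (0 : ℝ) < n := by exact_mod_cast hn
  have hx : 0 < 48000 * n * L := by positivity
  have hm0 : (0 : ℝ) < m := hx.trans_le hm1
  have hj : (0 : ℝ) ≤ j := Nat.cast_nonneg j
  have hp1 : (j + 1) * (48000 * L) ≤ p := Nat.le_ceil _
  have hp2 : (p : ℝ) ≤ 2 * ((j + 1) * (48000 * L)) := by
    have := (Nat.ceil_lt_add_one (a := (j + 1) * (48000 * L)) (by positivity)).le
    have h1 : 1 ≤ (j + 1) * (48000 * L) := by nlinarith
    change (⌈(j + 1) * (48000 * L)⌉₊ : ℝ) ≤ _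
    linarith
  have h2j : (1 : ℝ) ≤ 2 ^ j := one_le_pow₀ one_le_two
  refine ⟨by positivity, ?_, ?_, by nlinarith⟩
  · rw [mul_div_assoc', le_div_iff₀ hm0]
    calc (8 : ℝ) * m ≤ 8 * (2 * (48000 * n * L)) := by gcongr
      _ = (0 + 1) * (48000 * L) * (6 * 1 * n * (0 + 2) ^ 2 * (2 / 3)) := by ring
      _ ≤ (j + 1) * (48000 * L) * (6 * 2 ^ j * n * (j + 2) ^ 2 * 1) := by gcongr; norm_num
      _ ≤ p * (6 * 2 ^ j * n * (j + 2) ^ 2) := by rw [mul_one]; gcongr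
  · rw [mul_pow, mul_pow, Real.sq_sqrt (by positivity), mul_div_assoc', div_le_iff₀ hm0]
    calc p * (6 * 2 ^ j * n * (j + 2) ^ 2) ≤
          2 * ((j + 1) * (48000 * L)) * (6 * 2 ^ j * n * (j + 2) ^ 2) := by gcongr
      _ = (12 * (j + 1)) * (2 ^ j * (j + 2) ^ 2 * (48000 * n * L)) := by ring
      _ ≤ (5 ^ 2 * (j + 2) ^ 2) * (2 ^ j * (j + 2) ^ 2 * (48000 * n * L)) := by
        refine mul_le_mul_of_nonneg_right ?_ (by positivity)
        nlinarith
      _ = 5 ^ 2 * 2 ^ j * ((j + 2) ^ 2) ^ 2 * (48000 * n * L) := by ring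
      _ ≤ _ := by gcongr

/-- The oversampling bounds hold simultaneously on all levels with high probability, for the
density built from the spaces `V (2 ^ k * n)`. -/
theorem exists_density_forall_discrete_bounds [SecondCountableTopology X] [LocallyCompactSpace X]
    {V : ℕ → Submodule ℝ C(X, ℝ)} (hV : ∀ n, Module.finrank ℝ (V n) = n) {n m : ℕ} (hn : 2 ≤ n)
    (hm1 : 48000 * n * Real.log n ≤ m) (hm2 : m ≤ 2 * (48000 * n * Real.log n)) :
    ∃ ρ : X → ℝ, Measurable ρ ∧ (∀ x, 0 < ρ x) ∧ ∫ x, ρ x ∂μ = 1 ∧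
      ∀ {F : Set C(X, ℝ)} {a : C(X, ℝ) → ℕ → C(X, ℝ)} {ε : ℕ → ℝ} {S : Set (Fin m → X)},
        (∀ f ∈ F, ∀ k, a f k ∈ V (2 ^ k * n)) →
        (∀ f ∈ F, ∀ k, ‖ContinuousMap.toLp 2 μ ℝ (f - a f k)‖ ≤ ε k) →
        (∀ f ∈ F, ∀ k, ‖ContinuousMap.toLp 2 μ ℝ (f - a f (k + 1))‖ ≤ ε k) →
        (∀ k, 0 ≤ ε k) →
        (Summable fun k : ℕ => √(2 ^ k) * (k + 2) ^ 2 * ε k) →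
        (∀ χ, (∀ f ∈ F, ∀ k, Tendsto (fun j => a f j (χ k)) atTop (𝓝 (f (χ k)))) →
          (∀ g ∈ V n ⊔ V (2 * n), 1 / 2 * ‖ContinuousMap.toLp 2 μ ℝ g‖ ^ 2 ≤
            ∑ k, 1 / m * (ρ (χ k))⁻¹ * g (χ k) ^ 2) →
          (∀ j : ℕ, ∀ g ∈ V (2 ^ j * n) ⊔ V (2 ^ (j + 1) * n),
            ∑ k, 1 / m * (ρ (χ k))⁻¹ * g (χ k) ^ 2 ≤
              (5 * √(2 ^ j) * (j + 2) ^ 2 * ‖ContinuousMap.toLp 2 μ ℝ g‖) ^ 2) → χ ∈ S) →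
        1 - ENNReal.ofReal (1 / (48000 * (n : ℝ) ^ 2)) ≤
          Measure.pi (fun _ : Fin m => μ.withDensity fun x => ENNReal.ofReal (ρ x)) S := by
  have hn0 : (2 : ℝ) ≤ n := by exact_mod_cast hn
  have hn1 : (0 : ℝ) < n := by linarith
  have hL2 : 1 / 2 ≤ Real.log n := by
    have := Real.log_two_gt_d9
    exact le_trans (by linarith) (Real.log_le_log two_pos hn0)
  set L := Real.log n with hL
  have hL0 : 0 < L := by linarith
  have hm0 : (0 : ℝ) < m := lt_of_lt_of_le (by positivity) hm1
  have hfin : ∀ k, FiniteDimensional ℝ (V (2 ^ k * n)) := fun k =>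
    FiniteDimensional.of_finrank_pos (by rw [hV]; positivity)
  set W : ℕ → Submodule ℝ C(X, ℝ) := fun k => V (2 ^ k * n) ⊔ V (2 ^ (k + 1) * n) with hW
  have hWfin : ∀ k, FiniteDimensional ℝ (W k) := fun k => by
    have := hfin k
    have := hfin (k + 1)
    exact Submodule.finiteDimensional_sup _ _
  choose M hM e he using fun k => exists_isOrthonormalFrame μ (W k)
  have hMB : ∀ k, (M k : ℝ) ≤ 3 * 2 ^ k * n := fun k => by
    have := hfin k
    have := hfin (k + 1)
    have h1 : M k ≤ 2 ^ k * n + 2 ^ (k + 1) * n := by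
      refine (hM k).trans ((Submodule.finrank_add_le_finrank_add_finrank _ _).trans_eq ?_)
      rw [hV, hV]
    have h2 : (M k : ℝ) ≤ 2 ^ k * n + 2 ^ (k + 1) * n := by exact_mod_cast h1
    exact h2.trans_eq (by ring)
  obtain ⟨ρ, hρm, hρ0, hρ1, G, hGm, hG, hGρ⟩ :=
    exists_density he (B := fun k => 3 * 2 ^ k * n) (fun k => by positivity) hMB
  have := isProbabilityMeasure_withDensity_ofReal hρ0 hρ1
  refine ⟨ρ, hρm, hρ0, hρ1, fun {F a ε S} ha hε hε' hε0 hs hS => ?_⟩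
  set R : ℕ → ℝ := fun j => 6 * 2 ^ j * n * (j + 2) ^ 2 / m with hR
  set p : ℕ → ℕ := fun j => ⌈(j + 1) * (48000 * L)⌉₊ with hp
  have hpar : ∀ j, 0 < R j ∧ 8 ≤ p j * R j ∧ p j * R j ≤ (5 * √(2 ^ j) * (j + 2) ^ 2) ^ 2 ∧
      30 * (j + 1) * L ≤ p j / 3 :=
    sampling_parameters (by omega) hL0 hm1 hm2 (by linarith)
  have hK : ∀ j, ∀ x ∈ G, ∑ i, e j i x ^ 2 ≤ m * R j * ρ x := fun j x hx => by
    refine (hGρ x hx j).trans_eq ?_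
    simp only [hR]
    field_simp
    ring
  have hconv : ∀ᵐ x ∂μ, ∀ f ∈ F, Tendsto (fun k => a f k x) atTop (𝓝 (f x)) := by
    refine ae_forall_tendsto_apply he ha hε hε' ?_ ?_
    · refine squeeze_zero hε0 (fun k => ?_) hs.tendsto_atTop_zero
      have h1 : 1 ≤ √(2 ^ k) := Real.one_le_sqrt.2 (one_le_pow₀ one_le_two)
      have h2 : (1 : ℝ) ≤ (k + 2) ^ 2 := one_le_pow₀ (by linarith [(Nat.cast_nonneg k : (0 : ℝ) ≤ k)])
      exact le_mul_of_one_le_left (hε0 k) (one_le_mul_of_one_le_of_one_le h1 h2)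
    · filter_upwards [hG] with x hx
      refine Summable.of_nonneg_of_le (fun k => mul_nonneg (Real.sqrt_nonneg _) (hε0 k))
        (fun k => ?_) (hs.mul_left √(6 * n * ρ x))
      rw [← mul_assoc]
      refine mul_le_mul_of_nonneg_right (Real.sqrt_le_iff.2 ⟨by positivity, ?_⟩) (hε0 k)
      rw [mul_pow, mul_pow, Real.sq_sqrt (mul_nonneg (by positivity) (hρ0 x).le),
        Real.sq_sqrt (by positivity)]
      refine (hGρ x hx k).trans ?_
      have h2 : (1 : ℝ) ≤ (k + 2) ^ 2 := one_le_pow₀ (by linarith [(Nat.cast_nonneg k : (0 : ℝ) ≤ k)])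
      have h3 := hρ0 x
      calc 2 * (3 * 2 ^ k * n) * ((k : ℝ) + 2) ^ 2 * ρ x =
            6 * n * ρ x * (2 ^ k * ((k + 2) ^ 2 * 1)) := by ring
        _ ≤ 6 * n * ρ x * (2 ^ k * ((k + 2) ^ 2 * (k + 2) ^ 2)) := by gcongr
        _ = _ := by ring
  have hgood : ∀ᵐ χ ∂(Measure.pi fun _ : Fin m => μ.withDensity fun x => ENNReal.ofReal (ρ x)),
      ∀ k, χ k ∈ G ∩ μ.support ∧
        ∀ f ∈ F, Tendsto (fun j => a f j (χ k)) atTop (𝓝 (f (χ k))) := by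
    refine ae_pi_forall (p := fun x => x ∈ G ∩ μ.support ∧
      ∀ f ∈ F, Tendsto (fun j => a f j x) atTop (𝓝 (f x)))
      ((withDensity_absolutelyContinuous μ _).ae_le ?_)
    filter_upwards [hG, μ.support_mem_ae, hconv] with x h1 h2 h3
    exact ⟨⟨h1, h2⟩, h3⟩
  have hsum : ∀ (χ : Fin m → X) (g : C(X, ℝ)), ∑ k, 1 / m * (ρ (χ k))⁻¹ * g (χ k) ^ 2 =
      1 / m * ∑ k, (ρ (χ k))⁻¹ * g (χ k) ^ 2 := fun χ g => by
    rw [Finset.mul_sum]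
    exact Finset.sum_congr rfl fun k _ => mul_assoc _ _ _
  have hm0' : 0 < m := by exact_mod_cast hm0
  refine one_sub_le_measure_of_ae (by positivity) ?_
    ((measure_exists_discrete_lt_le hρm hρ0 hρ1 (he 0) hGm hG hm0' (hpar 0).1 (hK 0)).trans
      (ENNReal.ofReal_le_ofReal ?_))
    fun j => (measure_exists_discrete_gt_le hρm hρ0 hρ1 (he j) hGm hG hm0' (hpar j).1 (hK j)
      (hpar j).2.1).trans (ENNReal.ofReal_le_ofReal ?_)
  · filter_upwards [hgood] with χ hχ hA hB
    refine hS χ (fun f hf k => (hχ k).2 f hf) (fun g hg => ?_) (fun j g hg => ?_)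
    · rw [hsum]
      by_contra! hlt
      refine hA ⟨fun k => (hχ k).1, g, ?_, hlt⟩
      simpa [hW] using hg
    · rw [hsum]
      by_contra! hlt
      refine hB j ⟨fun k => (hχ k).1, g, hg, lt_of_le_of_lt ?_ hlt⟩
      rw [mul_pow _ ‖_‖]
      exact mul_le_mul_of_nonneg_right (hpar j).2.2.1 (sq_nonneg _)
  · have h1 : 30 * ((0 : ℕ) + 1) * L ≤ 3 / (200 * R 0) := by
      simp only [hR]
      rw [le_div_iff₀ (by positivity)]
      field_simp
      norm_num
      linarith
    calc (M 0 : ℝ) * Real.exp (-(3 / (200 * R 0))) ≤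
          3 * 2 ^ 0 * n * Real.exp (-(30 * ((0 : ℕ) + 1) * L)) := by gcongr; exact hMB 0
      _ ≤ _ := two_pow_mul_exp_log_le hn 0
      _ ≤ _ := mul_le_of_le_one_right (by positivity) (by norm_num)
  · calc (M j : ℝ) * Real.exp (-(p j / 3)) ≤
          3 * 2 ^ j * n * Real.exp (-(30 * (j + 1) * L)) := by
            gcongr
            · exact hMB j
            · exact (hpar j).2.2.2
      _ ≤ _ := two_pow_mul_exp_log_le hn j

end RandomWeightedLeastSquares

/-- weighted least squares with iid random points achieves the
best-approximation rate in `L_2` with high probability: for all `α > 1/2`,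
`β, C > 0` there are `b ∈ ℕ` and `c > 0` such that whenever `μ` is a Borel
probability measure on a compact `D ⊆ ℝ^d`, `(V_n)` are `n`-dimensional subspaces
of `C(D)` and `F ⊆ C(D)` satisfies
`sup_{f∈F} inf_{g∈V_n} ‖f−g‖_{L_2(μ)} ≤ C·n^{−α}(log n)^β` for all `n ≥ 2`, then for
every `n ≥ 2` there is a positive probability density `ρ_n` with `∫ ρ_n dμ = 1`
such that, with `m = ⌈b·n·log n⌉` independent points drawn from `ρ_n·dμ`, with
probability at least `1 − 1/(bn²)` every weighted least squares minimizer (with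
weights `ρ_n(x_k)⁻¹`) `g* ∈ V_n` of every `f ∈ F` satisfies
`‖f − g*‖_{L_2(μ)} ≤ c·n^{−α}(log n)^β`. -/
theorem random_weighted_least_squares_L2_rate
    (α β C : ℝ) (hα : 1 / 2 < α) (hβ : 0 < β) (hC : 0 < C) :
    ∃ b : ℕ, ∃ c : ℝ, 0 < c ∧
      ∀ (d : ℕ) (D : Set (Fin d → ℝ)), IsCompact D →
        ∀ μ : Measure D, IsProbabilityMeasure μ →
          ∀ V : ℕ → Submodule ℝ C(D, ℝ), (∀ n, Module.finrank ℝ (V n) = n) →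
            ∀ F : Set C(D, ℝ),
              (∀ n : ℕ, 2 ≤ n → ∀ f ∈ F,
                sInf {r : ℝ | ∃ g ∈ V n, r = (eLpNorm (⇑f - ⇑g) 2 μ).toReal} ≤
                  C * (n : ℝ) ^ (-α) * Real.log n ^ β) →
              ∀ n : ℕ, 2 ≤ n →
                ∃ ρ : D → ℝ, Measurable ρ ∧ (∀ y, 0 < ρ y) ∧ (∫ y, ρ y ∂μ) = 1 ∧
                  1 - ENNReal.ofReal (1 / ((b : ℝ) * (n : ℝ) ^ 2)) ≤
                    Measure.pi
                      (fun _ : Fin (Nat.ceil ((b : ℝ) * (n : ℝ) * Real.log n)) =>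
                        μ.withDensity fun y => ENNReal.ofReal (ρ y))
                      {χ | ∀ f ∈ F, ∀ g ∈ V n,
                        (∀ h ∈ V n,
                          ∑ k, (ρ (χ k))⁻¹ * |f (χ k) - g (χ k)| ^ 2 ≤
                            ∑ k, (ρ (χ k))⁻¹ * |f (χ k) - h (χ k)| ^ 2) →
                        eLpNorm (⇑f - ⇑g) 2 μ ≤
                          ENNReal.ofReal (c * (n : ℝ) ^ (-α) * Real.log n ^ β)} := by
  set θ : ℕ → ℝ := fun k => (2 ^ k : ℝ) ^ (-α) * (k + 2 : ℝ) ^ β with hθ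
  have hθ0 : ∀ k, 0 < θ k := fun k => by positivity
  set t : ℕ → ℝ := fun k => √(2 ^ k) * (k + 2) ^ 2 * θ k with ht
  have hts : Summable t := summable_sqrt_two_pow_mul_rpow hα β
  have ht0 : ∀ k, 0 ≤ t k := fun k => by have := hθ0 k; positivity
  set τ : ℝ := ∑' k, t k with hτ
  have hτθ : 4 * θ 0 ≤ τ := by
    refine le_trans (le_of_eq ?_) (hts.le_tsum 0 fun k _ => ht0 k)
    simp only [ht, pow_zero, Real.sqrt_one, Nat.cast_zero, zero_add, one_mul]
    norm_num
  have hτ0 : 0 < τ := by linarith [hθ0 0]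
  refine ⟨48000, 61 * C * τ, by positivity, fun d D hD μ _ V hV F hF n hn => ?_⟩
  have : CompactSpace D := isCompact_iff_compactSpace.1 hD
  have hn0 : (2 : ℝ) ≤ n := by exact_mod_cast hn
  have hL2 : 1 / 2 ≤ Real.log n := by
    have := Real.log_two_gt_d9
    exact le_trans (by linarith) (Real.log_le_log two_pos hn0)
  have hx : 1 ≤ 48000 * (n : ℝ) * Real.log n := by nlinarith
  obtain ⟨ρ, hρm, hρ0, hρ1, hρ⟩ := exists_density_forall_discrete_bounds (μ := μ) hV hn
    (m := ⌈((48000 : ℕ) : ℝ) * n * Real.log n⌉₊) (by push_cast; exact Nat.le_ceil _)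
    (by
      push_cast
      linarith [Nat.ceil_lt_add_one (a := 48000 * (n : ℝ) * Real.log n) (by linarith)])
  refine ⟨ρ, hρm, hρ0, hρ1, ?_⟩
  set A : ℝ := C * ((n : ℝ) ^ (-α) * Real.log n ^ β) with hA
  have hA0 : 0 < A := by
    have : 0 < Real.log n := by linarith
    positivity
  have happ : ∀ f ∈ F, ∀ k : ℕ, ∃ g ∈ V (2 ^ k * n), ‖ContinuousMap.toLp 2 μ ℝ (f - g)‖ ≤
      2 * (C * (((2 ^ k * n : ℕ) : ℝ) ^ (-α) * Real.log (2 ^ k * n : ℕ) ^ β)) := fun f hf k => by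
    have hN : 2 ≤ 2 ^ k * n := hn.trans (Nat.le_mul_of_pos_left _ (by positivity))
    have hN0 : (2 : ℝ) ≤ (2 ^ k * n : ℕ) := by exact_mod_cast hN
    have hlog : 0 < Real.log (2 ^ k * n : ℕ) := Real.log_pos (by linarith)
    refine exists_mem_norm_toLp_sub_le ((hF _ hN f hf).trans_eq (mul_assoc _ _ _)) ?_
    have : 0 < C * (((2 ^ k * n : ℕ) : ℝ) ^ (-α) * Real.log (2 ^ k * n : ℕ) ^ β) := by positivity
    linarith
  choose! a ha haε using happ
  have hε : ∀ f ∈ F, ∀ k i, i ≤ k + 1 → k ≤ i →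
      ‖ContinuousMap.toLp 2 μ ℝ (f - a f i)‖ ≤ 2 * A * θ k := fun f hf k i hik hki => by
    refine (haε f hf i).trans ?_
    have h1 := rpow_mul_log_rpow_le (α := α) (by linarith) hβ.le hn hik hki
    calc _ ≤ 2 * (C * (θ k * ((n : ℝ) ^ (-α) * Real.log n ^ β))) :=
          mul_le_mul_of_nonneg_left (mul_le_mul_of_nonneg_left h1 hC.le) zero_le_two
      _ = _ := by rw [hA]; ring
  refine hρ ha (fun f hf k => hε f hf k k (by omega) le_rfl)
    (fun f hf k => hε f hf k (k + 1) le_rfl (by omega))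
    (fun k => (mul_pos (mul_pos two_pos hA0) (hθ0 k)).le) ?_ fun χ hconv hlow hup f hf g hg hmin => ?_
  · exact (hts.mul_left (2 * A)).congr fun k => by simp only [ht]; ring
  rw [eLpNorm_sub_eq_ofReal_norm]
  refine ENNReal.ofReal_le_ofReal ?_
  have ha0 : a f 0 ∈ V n := by simpa using ha f hf 0
  have hσ : ∀ j, 0 ≤ 20 * A * t j := fun j => mul_nonneg (by positivity) (ht0 j)
  refine (norm_toLp_sub_le_of_minimizer (a := a f) (χ := χ) (σ := fun j => 20 * A * t j)
    (fun k => mul_nonneg (by positivity) (inv_nonneg.2 (hρ0 (χ k)).le)) (hts.mul_left _) (fun j => ?_)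
    hσ (hconv f hf) ?_ (hlow _ (Submodule.mem_sup_left (sub_mem ha0 hg)))).trans ?_
  · refine (hup j _ (sub_mem (Submodule.mem_sup_left (ha f hf j))
      (Submodule.mem_sup_right (ha f hf (j + 1))))).trans ?_
    refine pow_le_pow_left₀ (by positivity) ?_ 2
    calc _ ≤ 5 * √(2 ^ j) * (j + 2) ^ 2 * (2 * A * θ j + 2 * A * θ j) := by
          gcongr
          exact (norm_toLp_sub_le _ _ f).trans (add_le_add (hε f hf j j (by omega) le_rfl)
            (hε f hf j (j + 1) le_rfl (by omega)))
      _ = 20 * A * t j := by simp only [ht]; ring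
  · simp only [mul_assoc, ← Finset.mul_sum]
    exact mul_le_mul_of_nonneg_left (hmin _ ha0) (by positivity)
  · rw [tsum_mul_left]
    have h0 := hε f hf 0 0 (by omega) le_rfl
    calc _ ≤ 2 * A * θ 0 + 3 * (20 * A * τ) := by gcongr
      _ ≤ 61 * A * τ := by nlinarith
      _ = _ := by rw [hA]; ring
end
end
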